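/- arXiv:1903.08331 — 2 statements merged into one kernel-verified Lean document; each statement's English description precedes it below -/
import Mathlib

section
/- Let M ∈ ℕ with M ≥ 1. Let C3 = {q ∈ V_L : (V_q, σ) has the specification property} and C4 = {q ∈ V_L : (V_q, σ) is a synchronised subshift}, viewed as subsets of ℝ. Then the Hausdorff dimension of C3 equals 1 and the Hausdorff dimension of C4 equals 1. -/
open Classical

/-- The one-sided shift map on sequences. -/
def shift (x : ℕ → ℕ) : ℕ → ℕ := fun i => x (i + 1)

/-- Reflection of a sequence with respect to the alphabet `{0,…,M}`. -/
def reflSeq (M : ℕ) (x : ℕ → ℕ) : ℕ → ℕ := fun i => M - x i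

/-- Strict lexicographic order on sequences. -/
def lexLT (x y : ℕ → ℕ) : Prop := ∃ n : ℕ, (∀ i < n, x i = y i) ∧ x n < y n

/-- Lexicographic order on sequences. -/
def lexLE (x y : ℕ → ℕ) : Prop := x = y ∨ lexLT x y

/-- Strict lexicographic order on words (of the same length). -/
def wordLT (u v : List ℕ) : Prop :=
  ∃ n : ℕ, n < u.length ∧ (∀ i < n, u.getD i 0 = v.getD i 0) ∧ u.getD n 0 < v.getD n 0

/-- Lexicographic order on words (of the same length). -/
def wordLE (u v : List ℕ) : Prop := u = v ∨ wordLT u v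

/-- Membership in the full shift over the alphabet `{0,…,M}`. -/
def memSigma (M : ℕ) (x : ℕ → ℕ) : Prop := ∀ i, x i ≤ M

/-- `a` is the quasi-greedy expansion of `1` in base `q` over the alphabet `{0,…,M}`:
the lexicographically largest sequence with infinitely many nonzero entries satisfying
`∑ a_i q^{-i} = 1`. -/
def IsQuasiGreedy (M : ℕ) (q : ℝ) (a : ℕ → ℕ) : Prop :=
  memSigma M a ∧ (∀ n, ∃ m ≥ n, a m ≠ 0) ∧ (∑' i : ℕ, (a i : ℝ) / q ^ (i + 1)) = 1 ∧
    ∀ b : ℕ → ℕ, memSigma M b → (∀ n, ∃ m ≥ n, b m ≠ 0) →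
      (∑' i : ℕ, (b i : ℝ) / q ^ (i + 1)) = 1 → lexLE b a

/-- The quasi-greedy expansion of `1` in base `q` (as a global function, via choice). -/
noncomputable def qg (M : ℕ) (q : ℝ) : ℕ → ℕ :=
  if h : ∃ a, IsQuasiGreedy M q a then h.choose else fun _ => 0

/-- The set `V` of sequences `a` with `ā ≼ σⁿ(a) ≼ a` for all `n ≥ 0`. -/
def memV (M : ℕ) (a : ℕ → ℕ) : Prop :=
  memSigma M a ∧ ∀ n : ℕ, lexLE (reflSeq M a) (shift^[n] a) ∧ lexLE (shift^[n] a) a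

/-- The set `V_L` of bases `q ∈ (1, M+1]` with `α(q) ∈ V`. -/
def memVL (M : ℕ) (q : ℝ) : Prop := 1 < q ∧ q ≤ M + 1 ∧ memV M (qg M q)

/-- The symmetric `q`-shift `V_q`. -/
def Vq (M : ℕ) (q : ℝ) : Set (ℕ → ℕ) :=
  {x | memSigma M x ∧
    ∀ n : ℕ, lexLE (reflSeq M (qg M q)) (shift^[n] x) ∧ lexLE (shift^[n] x) (qg M q)}

/-- The word `w` occurs as a factor of the sequence `x`. -/
def IsFactorOf (w : List ℕ) (x : ℕ → ℕ) : Prop :=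
  ∃ k : ℕ, ∀ i < w.length, x (k + i) = w.getD i 0

/-- Membership in the language of a subshift `X`. -/
def InLang (X : Set (ℕ → ℕ)) (w : List ℕ) : Prop := ∃ x ∈ X, IsFactorOf w x

/-- The set of admissible words of length `k` of a subshift `X`. -/
def Bn (X : Set (ℕ → ℕ)) (k : ℕ) : Set (List ℕ) := {w | w.length = k ∧ InLang X w}

/-- The specification property. -/
def HasSpecification (X : Set (ℕ → ℕ)) : Prop :=
  ∃ S : ℕ, ∀ u v : List ℕ, InLang X u → InLang X v →
    ∃ w : List ℕ, w.length = S ∧ InLang X (u ++ w ++ v)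

/-- Topological transitivity (language formulation). -/
def IsTransitive (X : Set (ℕ → ℕ)) : Prop :=
  ∀ u v : List ℕ, InLang X u → InLang X v → ∃ w : List ℕ, InLang X (u ++ w ++ v)

/-- Topological mixing (language formulation). -/
def IsMixing (X : Set (ℕ → ℕ)) : Prop :=
  ∀ u v : List ℕ, InLang X u → InLang X v →
    ∃ N : ℕ, ∀ n ≥ N, ∃ w : List ℕ, w.length = n ∧ InLang X (u ++ w ++ v)

/-- Intrinsically synchronising word. -/
def IntrinsicallySynchronising (X : Set (ℕ → ℕ)) (w : List ℕ) : Prop :=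
  ∀ u v : List ℕ, InLang X (u ++ w) → InLang X (w ++ v) → InLang X (u ++ w ++ v)

/-- Synchronised subshift: transitive with an intrinsically synchronising word. -/
def IsSynchronised (X : Set (ℕ → ℕ)) : Prop :=
  IsTransitive X ∧ ∃ w : List ℕ, InLang X w ∧ IntrinsicallySynchronising X w

/-- Subshift of finite type over `{0,…,M}`: determined by a finite set of forbidden words. -/
def IsSFT (M : ℕ) (X : Set (ℕ → ℕ)) : Prop :=
  ∃ F : Finset (List ℕ), X = {x | memSigma M x ∧ ∀ w ∈ F, ¬ IsFactorOf w x}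

/-- Coded system: the closure of an increasing union of transitive subshifts of finite type. -/
def IsCoded (M : ℕ) (X : Set (ℕ → ℕ)) : Prop :=
  ∃ Y : ℕ → Set (ℕ → ℕ), (∀ n, IsSFT M (Y n) ∧ IsTransitive (Y n)) ∧
    (∀ n, Y n ⊆ Y (n + 1)) ∧ X = closure (⋃ n, Y n)

/-- `ω⁻`: decrease the last letter of a word by one. -/
def wMinus (w : List ℕ) : List ℕ := w.dropLast ++ [w.getLast! - 1]

/-- `ω⁺`: increase the last letter of a word by one. -/
def wPlus (w : List ℕ) : List ℕ := w.dropLast ++ [w.getLast! + 1]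

/-- Reflection of a word. -/
def wRefl (M : ℕ) (w : List ℕ) : List ℕ := w.map (fun c => M - c)

/-- `ω^∞`: the periodic sequence repeating the word `w`. -/
def perSeq (w : List ℕ) : ℕ → ℕ := fun i => w.getD (i % w.length) 0

/-- The sequence beginning with the word `u` followed by the periodic sequence `v^∞`. -/
def wordThenPer (u v : List ℕ) : ℕ → ℕ :=
  fun i => if i < u.length then u.getD i 0 else perSeq v (i - u.length)

/-- The prefix of length `n` of a sequence, as a word. -/
def prefixWord (a : ℕ → ℕ) (n : ℕ) : List ℕ := (List.range n).map a

/-- A sequence `a ∈ V` is irreducible if `a_1…a_j (\overline{a_1…a_j}⁺)^∞ ≺ a`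
whenever `(a_1…a_j⁻)^∞ ∈ V`. -/
def IrreducibleSeq (M : ℕ) (a : ℕ → ℕ) : Prop :=
  ∀ j : ℕ, 1 ≤ j → memV M (perSeq (wMinus (prefixWord a j))) →
    lexLT (wordThenPer (prefixWord a j) (wPlus (wRefl M (prefixWord a j)))) a

/-- The set `I` of irreducible bases. -/
def memI (M : ℕ) (q : ℝ) : Prop := memVL M q ∧ IrreducibleSeq M (qg M q)

/-- The set `U` of univoque bases. -/
def memU (M : ℕ) (q : ℝ) : Prop :=
  (1 < q ∧ q < M + 1 ∧ ∀ n : ℕ, 1 ≤ n →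
      lexLT (reflSeq M (qg M q)) (shift^[n] (qg M q)) ∧
        lexLT (shift^[n] (qg M q)) (qg M q)) ∨ q = M + 1

/-- The set `U̅`: closure of the set of univoque bases. -/
def memUbar (M : ℕ) (q : ℝ) : Prop :=
  1 < q ∧ q ≤ M + 1 ∧
    ∀ n : ℕ, lexLT (reflSeq M (qg M q)) (shift^[n] (qg M q)) ∧
      lexLE (shift^[n] (qg M q)) (qg M q)

/-- The indices `n_m` of the natural approximation from below (`approxIdx M q 0 = n_1`). -/
noncomputable def approxIdx (M : ℕ) (q : ℝ) : ℕ → ℕ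
  | 0 => sInf {n : ℕ | 1 ≤ n ∧ memV M (perSeq (wMinus (prefixWord (qg M q) n)))}
  | m + 1 => sInf {n : ℕ | approxIdx M q m < n ∧ memV M (perSeq (wMinus (prefixWord (qg M q) n)))}

/-- The base in `(1, M+1]` whose quasi-greedy expansion is `a` (via choice). -/
noncomputable def baseOf (M : ℕ) (a : ℕ → ℕ) : ℝ :=
  if h : ∃ q : ℝ, 1 < q ∧ q ≤ M + 1 ∧ qg M q = a then h.choose else 0

/-- The natural approximation from below of `q` (`approxBase M q 0 = q_1⁻`),
determined by `α(q_m⁻) = (α_1(q)…α_{n_m}(q)⁻)^∞`. -/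
noncomputable def approxBase (M : ℕ) (q : ℝ) (m : ℕ) : ℝ :=
  baseOf M (perSeq (wMinus (prefixWord (qg M q) (approxIdx M q m))))

/-- Strongly irreducible base: `q ∈ I` and all but finitely many terms of the natural
approximation from below lie in `I`. -/
def memSI (M : ℕ) (q : ℝ) : Prop :=
  memI M q ∧ ∃ N : ℕ, ∀ m ≥ N, memI M (approxBase M q m)

/-- Weakly irreducible base: `q ∈ I` but infinitely many terms of the natural
approximation from below are not in `I`. -/
def memWI (M : ℕ) (q : ℝ) : Prop :=
  memI M q ∧ ∀ N : ℕ, ∃ m ≥ N, ¬ memI M (approxBase M q m)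

/-- The generalised golden ratio `q_G(M)`. -/
noncomputable def qG (M : ℕ) : ℝ :=
  if M % 2 = 0 then ((M / 2 : ℕ) : ℝ) + 1
  else (((M / 2 : ℕ) : ℝ) + 1 +
    Real.sqrt (((M / 2 : ℕ) : ℝ) ^ 2 + 6 * ((M / 2 : ℕ) : ℝ) + 5)) / 2

/-- The metric on `Σ_M`: `d(x,y) = 2^{-j}` where `j` is the first (1-indexed) place
where `x` and `y` differ. -/
noncomputable def seqDist (x y : ℕ → ℕ) : ℝ :=
  if x = y then 0 else (1 / 2 : ℝ) ^ (sInf {i : ℕ | x i ≠ y i} + 1)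

/-- Fundamental word (Allaart). -/
def IsFundamentalWord (M : ℕ) (w : List ℕ) : Prop :=
  2 < w.length ∧ ∀ i : ℕ, 1 ≤ i → i ≤ w.length - 1 →
    wordLE (wRefl M (w.take (w.length - i))) (w.drop i) ∧
      wordLT (w.drop i) (w.take (w.length - i))

/-- The set `I_N`. -/
def memIN (M N : ℕ) (q : ℝ) : Prop :=
  memVL M q ∧
    prefixWord (qg M q) (2 * N) = List.replicate (2 * N - 1) M ++ [0] ∧
    ∀ r : ℕ, 2 ≤ r →
      wordLT (List.replicate N 0) ((List.range N).map (fun i => qg M q (r * N + i))) ∧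
      wordLT ((List.range N).map (fun i => qg M q (r * N + i))) (List.replicate N M)

/-- The (forward) orbit of a sequence under the shift. -/
def orbit (a : ℕ → ℕ) : Set (ℕ → ℕ) := {y | ∃ n : ℕ, y = shift^[n] a}

theorem shift_iterate_apply (x : ℕ → ℕ) (n i : ℕ) : shift^[n] x i = x (n + i) := by
  induction n generalizing x with
  | zero => simp
  | succ n ih =>
    rw [Function.iterate_succ_apply, ih]
    simp only [shift]
    congr 1
    omega

theorem shift_iterate_eq (x : ℕ → ℕ) (n : ℕ) : shift^[n] x = fun i => x (n + i) :=
  funext (shift_iterate_apply x n)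

/-- The symmetric subshift of sequences whose shifts all lie between `ā` and `a`. -/
def symShift (M : ℕ) (a : ℕ → ℕ) : Set (ℕ → ℕ) :=
  {x | memSigma M x ∧ ∀ n : ℕ, lexLE (reflSeq M a) (shift^[n] x) ∧ lexLE (shift^[n] x) a}

theorem mem_symShift_iff {M : ℕ} {a x : ℕ → ℕ} :
    x ∈ symShift M a ↔ memSigma M x ∧
      ∀ n : ℕ, lexLE (reflSeq M a) (fun i => x (n + i)) ∧ lexLE (fun i => x (n + i)) a := by
  simp only [symShift, Set.mem_ofPred_eq, shift_iterate_eq]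

theorem symShift_tail {M : ℕ} {a x : ℕ → ℕ} (hx : x ∈ symShift M a) (k : ℕ) :
    (fun i => x (k + i)) ∈ symShift M a := by
  rw [mem_symShift_iff] at hx ⊢
  refine ⟨fun i => hx.1 _, fun n => ?_⟩
  have := hx.2 (k + n)
  simpa only [add_assoc] using this

theorem lexLE_of_agree_left {u v a : ℕ → ℕ} {N : ℕ} (hu : lexLE u a)
    (hne : ∃ i < N, u i ≠ a i) (hv : ∀ i < N, v i = u i) : lexLE v a := by
  obtain ⟨i, hi, hne⟩ := hne
  rcases hu with rfl | ⟨n, hn, hlt⟩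
  · exact absurd rfl hne
  · have hni : n ≤ i := by
      by_contra! h
      exact hne (hn i h)
    refine Or.inr ⟨n, fun j hj => ?_, ?_⟩
    · rw [hv j (by omega), hn j hj]
    · rwa [hv n (by omega)]

theorem lexLE_of_agree_right {u v a : ℕ → ℕ} {N : ℕ} (hu : lexLE a u)
    (hne : ∃ i < N, u i ≠ a i) (hv : ∀ i < N, v i = u i) : lexLE a v := by
  obtain ⟨i, hi, hne⟩ := hne
  rcases hu with rfl | ⟨n, hn, hlt⟩
  · exact absurd rfl hne
  · have hni : n ≤ i := by
      by_contra! h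
      exact hne (hn i h).symm
    refine Or.inr ⟨n, fun j hj => ?_, ?_⟩
    · rw [hv j (by omega), hn j hj]
    · rwa [hv n (by omega)]

theorem reflSeq_reflSeq {M : ℕ} {x : ℕ → ℕ} (hx : memSigma M x) :
    reflSeq M (reflSeq M x) = x := by
  funext i
  have := hx i
  simp only [reflSeq]
  omega

theorem lexLE_reflSeq {M : ℕ} {x y : ℕ → ℕ} (hx : memSigma M x) (hxy : lexLE y x) :
    lexLE (reflSeq M x) (reflSeq M y) := by
  rcases hxy with rfl | ⟨n, hn, hlt⟩
  · exact Or.inl rfl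
  · refine Or.inr ⟨n, fun i hi => ?_, ?_⟩
    · simp only [reflSeq, hn i hi]
    · have := hx n
      simp only [reflSeq]
      omega

theorem reflSeq_mem_symShift {M : ℕ} {a x : ℕ → ℕ} (ha : memSigma M a)
    (hx : x ∈ symShift M a) : reflSeq M x ∈ symShift M a := by
  rw [mem_symShift_iff] at hx ⊢
  refine ⟨fun i => Nat.sub_le _ _, fun n => ⟨?_, ?_⟩⟩
  · exact lexLE_reflSeq ha (hx.2 n).2
  · have := lexLE_reflSeq (M := M) (fun i => hx.1 _) (hx.2 n).1
    rwa [reflSeq_reflSeq ha] at this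

theorem lexLT_of_head {M K : ℕ} {a y : ℕ → ℕ} (ha : ∀ i < K, a i = M) (hy : memSigma M y)
    (h : ∃ j < K, y j < M) : lexLT y a := by
  have hex : ∃ j, y j < M := h.imp fun _ h => h.2
  obtain ⟨j, hj, hjM⟩ := h
  have hle := Nat.find_min' hex hjM
  refine ⟨Nat.find hex, fun i hi => ?_, ?_⟩
  · have h1 := Nat.find_min hex hi
    have h2 := hy i
    rw [ha i (by omega)]
    omega
  · rw [ha _ (by omega)]
    exact Nat.find_spec hex

theorem reflSeq_lexLT_of_head {M K : ℕ} {a y : ℕ → ℕ} (ha : ∀ i < K, a i = M)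
    (h : ∃ j < K, 0 < y j) : lexLT (reflSeq M a) y := by
  have hex : ∃ j, 0 < y j := h.imp fun _ h => h.2
  obtain ⟨j, hj, hjM⟩ := h
  have hle := Nat.find_min' hex hjM
  refine ⟨Nat.find hex, fun i hi => ?_, ?_⟩
  · have h1 := Nat.find_min hex hi
    simp only [reflSeq]
    rw [ha i (by omega)]
    omega
  · simp only [reflSeq]
    rw [ha _ (by omega)]
    have := Nat.find_spec hex
    omega

/-- Sequences consisting of a long initial run of `M` followed by blocks of length `P`, each of
which starts with the word `0M`. -/
structure IsBlockSeq (M P : ℕ) (a : ℕ → ℕ) : Prop where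
  le : memSigma M a
  head : ∀ i < P + 4, a i = M
  zero : ∀ t, a (P + 4 + P * t) = 0
  top : ∀ t, a (P + 4 + P * t + 1) = M

theorem exists_block_start {P : ℕ} (hP : 2 ≤ P) (m : ℕ) :
    ∃ t, m ≤ P + 4 + P * t ∧ (P + 4 + P * t < m + P ∨ t = 0) := by
  rcases le_total m (P + 4) with h | h
  · exact ⟨0, by simpa using h, Or.inr rfl⟩
  · obtain ⟨d, rfl⟩ := Nat.exists_eq_add_of_le h
    refine ⟨(d + (P - 1)) / P, ?_, Or.inl ?_⟩
    · have := Nat.lt_div_mul_add (a := d + (P - 1)) (b := P) (by omega)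
      rw [mul_comm] at this
      omega
    · have := Nat.mul_div_le (d + (P - 1)) P
      omega

namespace IsBlockSeq

variable {M P : ℕ} {a : ℕ → ℕ}

theorem exists_window (ha : IsBlockSeq M P a) (hP : 2 ≤ P) {i : ℕ} (hi : 1 ≤ i) :
    (∃ j < P + 4, a (i + j) = 0) ∧ ∃ j < P + 4, a (i + j) = M := by
  obtain ⟨t, ht, ht'⟩ := exists_block_start hP i
  have h1 := ha.zero t
  have h2 := ha.top t
  rcases lt_or_ge i (P + 4) with h | h
  · have h3 := ha.zero 0
    simp only [mul_zero, add_zero] at h3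
    exact ⟨⟨P + 4 - i, by omega, by rwa [show i + (P + 4 - i) = P + 4 by omega]⟩,
      ⟨0, by omega, ha.head _ (by omega)⟩⟩
  · have ht2 : P + 4 + P * t < i + P := by
      rcases ht' with h' | rfl
      · exact h'
      · simp only [mul_zero]; omega
    refine ⟨⟨P + 4 + P * t - i, by omega, ?_⟩, ⟨P + 4 + P * t + 1 - i, by omega, ?_⟩⟩
    · rwa [show i + (P + 4 + P * t - i) = P + 4 + P * t by omega]
    · rwa [show i + (P + 4 + P * t + 1 - i) = P + 4 + P * t + 1 by omega]

theorem mem_symShift (ha : IsBlockSeq M P a) (hM : 1 ≤ M) (hP : 2 ≤ P) : a ∈ symShift M a := by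
  rw [mem_symShift_iff]
  refine ⟨ha.le, fun n => ?_⟩
  rcases Nat.eq_zero_or_pos n with rfl | hn
  · simp only [zero_add]
    refine ⟨Or.inr (reflSeq_lexLT_of_head ha.head ⟨0, by omega, ?_⟩), Or.inl rfl⟩
    rw [ha.head 0 (by omega)]; omega
  · obtain ⟨⟨j, hj, hj0⟩, k, hk, hkM⟩ := ha.exists_window hP hn
    exact ⟨Or.inr (reflSeq_lexLT_of_head ha.head ⟨k, hk, by simp only [hkM]; omega⟩),
      Or.inr (lexLT_of_head ha.head (fun i => ha.le _) ⟨j, hj, by simp only [hj0]; omega⟩)⟩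

/-- Follow `a` up to a block boundary, leave it downwards, and join `z` by an alternating word;
the resulting sequence has `a` as a long prefix, and `z` as its tail from a prescribed place on. -/
theorem exists_bridge (ha : IsBlockSeq M P a) (hM : 1 ≤ M) (hP : 2 ≤ P) (m : ℕ) {z : ℕ → ℕ}
    (hz : z ∈ symShift M a) :
    ∃ β ∈ symShift M a, (∀ i < m, β i = a i) ∧ ∀ i, β (m + (P + 8) + i) = z i := by
  obtain ⟨t, ht, ht'⟩ := exists_block_start hP m
  obtain ⟨m', hm'⟩ : ∃ m', m' = P + 4 + P * t := ⟨_, rfl⟩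
  have hPt : m' ≤ m + P + 4 := by
    rcases ht' with h | rfl
    · omega
    · simp only [mul_zero] at hm'; omega
  obtain ⟨e, he⟩ : ∃ e, e = if z 0 = 0 then M else 0 := ⟨_, rfl⟩
  obtain ⟨β, hβ⟩ : ∃ β : ℕ → ℕ, β = fun i => if i < m' then a i else if i < m' + 2 then 0 else
      if i < m + (P + 8) then (if (m + (P + 8) - 1 - i) % 2 = 0 then e else M - e)
      else z (i - (m + (P + 8))) := ⟨_, rfl⟩
  have hz' := mem_symShift_iff.1 hz
  have heM : e ≤ M := by rw [he]; split_ifs <;> omega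
  have b1 : ∀ i < m', β i = a i := fun i hi => by simp only [hβ, if_pos hi]
  have b2 : ∀ i, m' ≤ i → i < m' + 2 → β i = 0 := fun i h1 h2 => by
    simp only [hβ, if_neg (not_lt.2 h1), if_pos h2]
  have b3 : ∀ i, m' + 2 ≤ i → i < m + (P + 8) →
      β i = if (m + (P + 8) - 1 - i) % 2 = 0 then e else M - e := fun i h1 h2 => by
    simp only [hβ, if_neg (show ¬ i < m' by omega), if_neg (not_lt.2 h1), if_pos h2]
  have b4 : ∀ i, β (m + (P + 8) + i) = z i := fun i => by
    simp only [hβ, if_neg (show ¬ m + (P + 8) + i < m' by omega),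
      if_neg (show ¬ m + (P + 8) + i < m' + 2 by omega),
      if_neg (show ¬ m + (P + 8) + i < m + (P + 8) by omega)]
    congr 1
    omega
  have hβM : memSigma M β := fun i => by
    have h1 := ha.le i
    have h2 := hz'.1 (i - (m + (P + 8)))
    simp only [hβ]
    split_ifs <;> omega
  have pad : ∀ i, m' + 2 ≤ i → i < m + (P + 8) →
      (∃ j < 2, β (i + j) < M) ∧ ∃ j < 2, 0 < β (i + j) := by
    intro i h1 h2
    have hi := b3 i h1 h2
    have hpair : (β i < M ∨ β (i + 1) < M) ∧ (0 < β i ∨ 0 < β (i + 1)) := by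
      rcases Nat.lt_or_ge (i + 1) (m + (P + 8)) with h | h
      · have hi' := b3 (i + 1) (by omega) h
        rw [hi, hi', he]
        split_ifs <;> omega
      · have hi' : β (i + 1) = z 0 := by
          rw [← b4 0]; congr 1; omega
        rw [hi, hi', he, if_pos (by omega)]
        split_ifs <;> omega
    refine ⟨?_, ?_⟩
    · rcases hpair.1 with h | h
      · exact ⟨0, by omega, h⟩
      · exact ⟨1, by omega, h⟩
    · rcases hpair.2 with h | h
      · exact ⟨0, by omega, h⟩
      · exact ⟨1, by omega, h⟩
  have mixed : ∀ i, 1 ≤ i → i < m + (P + 8) →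
      (∃ j < P + 4, β (i + j) < M) ∧ ∃ j < P + 4, 0 < β (i + j) := by
    intro i h1 h2
    obtain ⟨-, c, hc, hcpos⟩ := pad (m' + 2) le_rfl (by omega)
    rcases Nat.lt_or_ge i (m' + 2) with h | h
    swap
    · obtain ⟨⟨j, hj, hj'⟩, k, hk, hk'⟩ := pad i h h2
      exact ⟨⟨j, by omega, hj'⟩, k, by omega, hk'⟩
    have hm0 : β m' = 0 := b2 m' le_rfl (by omega)
    have hm1 : β (m' + 1) = 0 := b2 (m' + 1) (by omega) (by omega)
    rcases Nat.lt_or_ge i m' with hi | hi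
    swap
    · refine ⟨⟨0, by omega, ?_⟩, ⟨m' + 2 + c - i, by omega, ?_⟩⟩
      · rw [add_zero, b2 i hi h]; omega
      · rwa [show i + (m' + 2 + c - i) = m' + 2 + c by omega]
    rcases Nat.lt_or_ge i (P + 4) with hiP | hiP
    · refine ⟨⟨P + 4 - i, by omega, ?_⟩, ⟨0, by omega, ?_⟩⟩
      · rw [show i + (P + 4 - i) = P + 4 by omega]
        rcases Nat.eq_zero_or_pos t with rfl | htpos
        · rw [mul_zero, add_zero] at hm'
          rw [← hm', hm0]; omega
        · have := ha.zero 0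
          have : P ≤ P * t := Nat.le_mul_of_pos_right _ htpos
          rw [b1 _ (by omega), ← add_zero (P + 4), ← mul_zero P, ha.zero 0]; omega
      · rw [add_zero, b1 i hi, ha.head i hiP]; omega
    · obtain ⟨s, hs, hs'⟩ := exists_block_start hP i
      have hs2 : P + 4 + P * s < i + P := by
        rcases hs' with h' | rfl
        · exact h'
        · simp only [mul_zero]; omega
      rcases Nat.lt_or_ge s t with hst | hst
      · have : P * (s + 1) ≤ P * t := Nat.mul_le_mul_left _ hst
        rw [mul_add, mul_one] at this
        refine ⟨⟨P + 4 + P * s - i, by omega, ?_⟩, ⟨P + 4 + P * s + 1 - i, by omega, ?_⟩⟩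
        · rw [show i + (P + 4 + P * s - i) = P + 4 + P * s by omega, b1 _ (by omega), ha.zero]
          omega
        · rw [show i + (P + 4 + P * s + 1 - i) = P + 4 + P * s + 1 by omega, b1 _ (by omega),
            ha.top]
          omega
      · have : P * t ≤ P * s := Nat.mul_le_mul_left _ hst
        refine ⟨⟨m' - i, by omega, ?_⟩, ⟨m' + 2 + c - i, by omega, ?_⟩⟩
        · rw [show i + (m' - i) = m' by omega, hm0]; omega
        · rwa [show i + (m' + 2 + c - i) = m' + 2 + c by omega]
  refine ⟨β, mem_symShift_iff.2 ⟨hβM, fun n => ?_⟩, fun i hi => b1 i (by omega), b4⟩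
  rcases Nat.eq_zero_or_pos n with rfl | hn
  · simp only [zero_add]
    refine ⟨Or.inr (reflSeq_lexLT_of_head ha.head ⟨0, by omega, ?_⟩),
      Or.inr ⟨m' + 1, fun i hi => ?_, ?_⟩⟩
    · rw [b1 0 (by omega), ha.head 0 (by omega)]; omega
    · change β i = a i
      rcases Nat.lt_or_ge i m' with h | h
      · exact b1 i h
      · rw [b2 i h (by omega), show i = P + 4 + P * t by omega, ha.zero]
    · change β (m' + 1) < a (m' + 1)
      rw [b2 _ (by omega) (by omega), hm', ha.top]; omega
  · rcases Nat.lt_or_ge n (m + (P + 8)) with h | h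
    · obtain ⟨h1, h2⟩ := mixed n hn h
      exact ⟨Or.inr (reflSeq_lexLT_of_head ha.head h2),
        Or.inr (lexLT_of_head ha.head (fun i => hβM _) h1)⟩
    · obtain ⟨d, rfl⟩ := Nat.exists_eq_add_of_le h
      simp only [add_assoc (m + (P + 8)), b4]
      exact hz'.2 d

theorem exists_join_of_prefix (ha : IsBlockSeq M P a) (hM : 1 ≤ M) (hP : 2 ≤ P) {x z : ℕ → ℕ}
    (hx : x ∈ symShift M a) (hz : z ∈ symShift M a) {n p : ℕ} (hpn : p ≤ n)
    (hp : ∀ i, p + i < n → x (p + i) = a i)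
    (hlt : ∀ s < p, (∃ i, s + i < n ∧ x (s + i) ≠ a i) ∧
      ∃ i, s + i < n ∧ x (s + i) ≠ M - a i) :
    ∃ y ∈ symShift M a, (∀ i < n, y i = x i) ∧ ∀ i, y (n + (P + 8) + i) = z i := by
  obtain ⟨m, rfl⟩ := Nat.exists_eq_add_of_le hpn
  obtain ⟨β, hβ, hβa, hβz⟩ := ha.exists_bridge hM hP m hz
  obtain ⟨y, hy⟩ : ∃ y : ℕ → ℕ, y = fun i => if i < p then x i else β (i - p) := ⟨_, rfl⟩
  have y1 : ∀ i < p, y i = x i := fun i hi => by simp only [hy, if_pos hi]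
  have y2 : ∀ i, y (p + i) = β i := fun i => by
    simp only [hy, if_neg (show ¬ p + i < p by omega)]
    congr 1
    omega
  have yx : ∀ i < p + m, y i = x i := fun i hi => by
    rcases Nat.lt_or_ge i p with h | h
    · exact y1 i h
    · obtain ⟨d, rfl⟩ := Nat.exists_eq_add_of_le h
      rw [y2, hβa d (by omega), hp d hi]
  rw [mem_symShift_iff] at hx hβ
  refine ⟨y, mem_symShift_iff.2 ⟨fun i => ?_, fun s => ?_⟩, yx, fun i => ?_⟩
  · rcases Nat.lt_or_ge i p with h | h
    · rw [y1 i h]; exact hx.1 i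
    · obtain ⟨d, rfl⟩ := Nat.exists_eq_add_of_le h
      rw [y2]; exact hβ.1 d
  · rcases Nat.lt_or_ge s p with h | h
    · obtain ⟨⟨i, hi, hne⟩, j, hj, hne'⟩ := hlt s h
      have hag : ∀ i < p + m - s, y (s + i) = x (s + i) := fun i hi => yx _ (by omega)
      exact ⟨lexLE_of_agree_right (hx.2 s).1 ⟨j, by omega, hne'⟩ hag,
        lexLE_of_agree_left (hx.2 s).2 ⟨i, by omega, hne⟩ hag⟩
    · obtain ⟨d, rfl⟩ := Nat.exists_eq_add_of_le h
      simp only [add_assoc, y2]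
      exact hβ.2 d
  · rw [show p + m + (P + 8) + i = p + (m + (P + 8) + i) by omega, y2, hβz]

theorem exists_join (ha : IsBlockSeq M P a) (hM : 1 ≤ M) (hP : 2 ≤ P) {x z : ℕ → ℕ}
    (hx : x ∈ symShift M a) (hz : z ∈ symShift M a) (n : ℕ) :
    ∃ y ∈ symShift M a, (∀ i < n, y i = x i) ∧ ∀ i, y (n + (P + 8) + i) = z i := by
  have hex : ∃ p, (∀ i, p + i < n → x (p + i) = a i) ∨ ∀ i, p + i < n → x (p + i) = M - a i :=
    ⟨n, Or.inl fun i hi => by omega⟩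
  have hpn : Nat.find hex ≤ n := Nat.find_min' hex (Or.inl fun i hi => by omega)
  have hmin : ∀ s < Nat.find hex, (∃ i, s + i < n ∧ x (s + i) ≠ a i) ∧
      ∃ i, s + i < n ∧ x (s + i) ≠ M - a i := fun s hs => by
    have := Nat.find_min hex hs
    push Not at this
    exact this
  rcases Nat.find_spec hex with hp | hp
  · exact ha.exists_join_of_prefix hM hP hx hz hpn hp hmin
  · have hxM := (mem_symShift_iff.1 hx).1
    have haM := ha.le
    obtain ⟨y, hy, hyx, hyz⟩ := ha.exists_join_of_prefix hM hP
      (reflSeq_mem_symShift ha.le hx) (reflSeq_mem_symShift ha.le hz) hpn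
      (fun i hi => by
        have h1 := hp i hi
        have h2 := haM i
        simp only [reflSeq]
        omega)
      (fun s hs => by
        obtain ⟨⟨i, hi, hne⟩, j, hj, hne'⟩ := hmin s hs
        refine ⟨⟨j, hj, ?_⟩, ⟨i, hi, ?_⟩⟩
        · have h1 := hxM (s + j)
          have h2 := haM j
          simp only [reflSeq]
          omega
        · have h1 := hxM (s + i)
          have h2 := haM i
          simp only [reflSeq]
          omega)
    refine ⟨reflSeq M y, reflSeq_mem_symShift ha.le hy, fun i hi => ?_, fun i => ?_⟩
    · have h1 := hyx i hi
      have h2 := hxM i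
      simp only [reflSeq] at h1 ⊢
      omega
    · have h1 := hyz i
      have h2 := (mem_symShift_iff.1 hz).1 i
      simp only [reflSeq] at h1 ⊢
      omega

end IsBlockSeq

theorem inLang_symShift_iff {M : ℕ} {a : ℕ → ℕ} {w : List ℕ} :
    InLang (symShift M a) w ↔ ∃ x ∈ symShift M a, ∀ i < w.length, x i = w.getD i 0 := by
  constructor
  · rintro ⟨x, hx, k, hk⟩
    exact ⟨_, symShift_tail hx k, hk⟩
  · rintro ⟨x, hx, h⟩
    exact ⟨x, hx, 0, by simpa using h⟩

theorem forall_getD_append {x : ℕ → ℕ} {u v : List ℕ} :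
    (∀ i < (u ++ v).length, x i = (u ++ v).getD i 0) ↔
      (∀ i < u.length, x i = u.getD i 0) ∧ ∀ i < v.length, x (u.length + i) = v.getD i 0 := by
  rw [List.length_append]
  constructor
  · intro h
    refine ⟨fun i hi => ?_, fun i hi => ?_⟩
    · rw [h i (by omega), List.getD_append _ _ _ _ hi]
    · rw [h _ (by omega), List.getD_append_right _ _ _ _ (by omega), Nat.add_sub_cancel_left]
  · rintro ⟨h1, h2⟩ i hi
    rcases Nat.lt_or_ge i u.length with h | h
    · rw [h1 i h, List.getD_append _ _ _ _ h]
    · obtain ⟨d, rfl⟩ := Nat.exists_eq_add_of_le h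
      rw [h2 d (by omega), List.getD_append_right _ _ _ _ (by omega), Nat.add_sub_cancel_left]

namespace IsBlockSeq

variable {M P : ℕ} {a : ℕ → ℕ}

theorem hasSpecification (ha : IsBlockSeq M P a) (hM : 1 ≤ M) (hP : 2 ≤ P) :
    HasSpecification (symShift M a) := by
  refine ⟨P + 8, fun u v hu hv => ?_⟩
  obtain ⟨x, hx, hxu⟩ := inLang_symShift_iff.1 hu
  obtain ⟨z, hz, hzv⟩ := inLang_symShift_iff.1 hv
  obtain ⟨y, hy, hyx, hyz⟩ := ha.exists_join hM hP hx hz u.length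
  refine ⟨List.ofFn fun i : Fin (P + 8) => y (u.length + i), List.length_ofFn,
    inLang_symShift_iff.2 ⟨y, hy, ?_⟩⟩
  rw [forall_getD_append, forall_getD_append]
  refine ⟨⟨fun i hi => by rw [hyx i hi, hxu i hi], fun i hi => ?_⟩, fun i hi => ?_⟩
  · rw [List.getD_eq_getElem _ _ hi, List.getElem_ofFn]
  · rw [List.length_append, List.length_ofFn, hyz, hzv i hi]

/-- The word `M0^P`, which occurs neither in `a` nor in its reflection. -/
def syncWord (M P : ℕ) : List ℕ := M :: List.replicate P 0

theorem syncWord_getD_succ {M P i : ℕ} : (syncWord M P).getD (i + 1) 0 = 0 := by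
  simp [syncWord]

theorem not_forall_eq_syncWord (ha : IsBlockSeq M P a) (hM : 1 ≤ M) (hP : 2 ≤ P) (k : ℕ) :
    (∃ i < P + 1, a (k + i) ≠ (syncWord M P).getD i 0) ∧
      ∃ i < P + 1, M - a (k + i) ≠ (syncWord M P).getD i 0 := by
  have key : P + 4 ≤ k + 1 → ∃ t, k + 1 ≤ P + 4 + P * t ∧ P + 4 + P * t < k + 1 + P := fun h => by
    obtain ⟨t, ht, ht'⟩ := exists_block_start hP (k + 1)
    refine ⟨t, ht, ?_⟩
    rcases ht' with h' | rfl
    · exact h'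
    · simp only [mul_zero]; omega
  constructor
  · by_contra! hcon
    have h0 : ∀ i < P, a (k + 1 + i) = 0 := fun i hi => by
      rw [add_assoc, add_comm 1, hcon (i + 1) (by omega), syncWord_getD_succ]
    rcases Nat.lt_or_ge (k + 1) (P + 4) with h | h
    · have := h0 0 (by omega)
      rw [ha.head _ (by omega)] at this
      omega
    · obtain ⟨t, ht, ht'⟩ := key h
      rcases Nat.lt_or_ge (P + 4 + P * t + 1) (k + 1 + P) with h' | h'
      · have := h0 (P + 4 + P * t + 1 - (k + 1)) (by omega)
        rw [show k + 1 + (P + 4 + P * t + 1 - (k + 1)) = P + 4 + P * t + 1 by omega, ha.top] at this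
        omega
      · rcases Nat.eq_zero_or_pos t with rfl | htpos
        · simp only [mul_zero] at ht ht' h'
          omega
        · obtain ⟨s, rfl⟩ := Nat.exists_eq_add_of_lt htpos
          have := h0 0 (by omega)
          rw [mul_add, mul_one] at h' ht'
          have h3 := ha.top (0 + s)
          rw [show P + 4 + P * (0 + s) + 1 = k + 1 + 0 by omega] at h3
          omega
  · by_contra! hcon
    have h0 : ∀ i < P, a (k + 1 + i) = M := fun i hi => by
      have := hcon (i + 1) (by omega)
      rw [syncWord_getD_succ] at this
      have h2 := ha.le (k + 1 + i)
      rw [show k + (i + 1) = k + 1 + i by omega] at this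
      omega
    have h1 : a k = 0 := by
      have := hcon 0 (by omega)
      have h2 := ha.le k
      simp [syncWord] at this
      omega
    rcases Nat.lt_or_ge (k + 1) (P + 4) with h | h
    · rw [ha.head _ (by omega)] at h1
      omega
    · obtain ⟨t, ht, ht'⟩ := key h
      have := h0 (P + 4 + P * t - (k + 1)) (by omega)
      rw [show k + 1 + (P + 4 + P * t - (k + 1)) = P + 4 + P * t by omega, ha.zero] at this
      omega

theorem inLang_syncWord (ha : IsBlockSeq M P a) (hM : 1 ≤ M) (hP : 2 ≤ P) :
    InLang (symShift M a) (syncWord M P) := by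
  have hx : memSigma M (fun i => if i % (P + 1) = 0 then M else 0) := fun i => by
    simp only; split_ifs <;> omega
  refine inLang_symShift_iff.2 ⟨fun i => if i % (P + 1) = 0 then M else 0,
    mem_symShift_iff.2 ⟨hx, fun n => ?_⟩, ?_⟩
  · have hd := Nat.div_add_mod n (P + 1)
    have hm : n % (P + 1) < P + 1 := Nat.mod_lt n (Nat.succ_pos P)
    have h0 : (n + (P + 1 - n % (P + 1))) % (P + 1) = 0 := by
      rw [show n + (P + 1 - n % (P + 1)) = (P + 1) * (n / (P + 1) + 1) by
        rw [mul_add, mul_one]; omega]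
      exact Nat.mul_mod_right _ _
    have h1 : (n + (P + 1 - n % (P + 1) + 1)) % (P + 1) = 1 := by
      rw [← add_assoc, Nat.add_mod, h0, zero_add, Nat.mod_mod, Nat.mod_eq_of_lt (by omega)]
    refine ⟨Or.inr (reflSeq_lexLT_of_head ha.head ⟨P + 1 - n % (P + 1), by omega, ?_⟩),
      Or.inr (lexLT_of_head ha.head (fun i => hx _) ⟨P + 1 - n % (P + 1) + 1, by omega, ?_⟩)⟩
    · simp only [h0, if_true]; omega
    · simp only [h1, one_ne_zero, if_false]; omega
  · intro i hi
    simp only [syncWord, List.length_cons, List.length_replicate] at hi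
    cases i with
    | zero => simp [syncWord]
    | succ i =>
      simp only [syncWord_getD_succ, Nat.mod_eq_of_lt hi, if_neg (Nat.succ_ne_zero i)]

theorem intrinsicallySynchronising_syncWord (ha : IsBlockSeq M P a) (hM : 1 ≤ M) (hP : 2 ≤ P) :
    IntrinsicallySynchronising (symShift M a) (syncWord M P) := by
  intro u v hu hv
  obtain ⟨x, hx, hxu⟩ := inLang_symShift_iff.1 hu
  obtain ⟨z, hz, hzv⟩ := inLang_symShift_iff.1 hv
  rw [forall_getD_append] at hxu hzv
  have hlen : (syncWord M P).length = P + 1 := by simp [syncWord]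
  obtain ⟨y, hy⟩ : ∃ y : ℕ → ℕ, y = fun i => if i < u.length then x i else z (i - u.length) :=
    ⟨_, rfl⟩
  have y1 : ∀ i < u.length, y i = x i := fun i hi => by simp only [hy, if_pos hi]
  have y2 : ∀ i, y (u.length + i) = z i := fun i => by
    simp only [hy, if_neg (show ¬ u.length + i < u.length by omega)]
    congr 1
    omega
  have yx : ∀ i < u.length + (P + 1), y i = x i := fun i hi => by
    rcases Nat.lt_or_ge i u.length with h | h
    · exact y1 i h
    · obtain ⟨d, rfl⟩ := Nat.exists_eq_add_of_le h
      rw [y2, hzv.1 d (by omega), hxu.2 d (by omega)]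
  rw [mem_symShift_iff] at hx hz
  refine inLang_symShift_iff.2 ⟨y, mem_symShift_iff.2 ⟨fun i => ?_, fun s => ?_⟩, ?_⟩
  · rcases Nat.lt_or_ge i u.length with h | h
    · rw [y1 i h]; exact hx.1 i
    · obtain ⟨d, rfl⟩ := Nat.exists_eq_add_of_le h
      rw [y2]; exact hz.1 d
  · rcases Nat.lt_or_ge s u.length with h | h
    · obtain ⟨⟨i, hi, hne⟩, j, hj, hne'⟩ := ha.not_forall_eq_syncWord hM hP (u.length - s)
      have hag : ∀ i < u.length + (P + 1) - s, y (s + i) = x (s + i) := fun i hi => yx _ (by omega)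
      rw [← hxu.2 i (by omega)] at hne
      rw [← hxu.2 j (by omega)] at hne'
      refine ⟨lexLE_of_agree_right (hx.2 s).1 ⟨u.length - s + j, by omega, ?_⟩ hag,
        lexLE_of_agree_left (hx.2 s).2 ⟨u.length - s + i, by omega, ?_⟩ hag⟩
      · rw [show s + (u.length - s + j) = u.length + j by omega]
        exact hne'.symm
      · rw [show s + (u.length - s + i) = u.length + i by omega]
        exact hne.symm
    · obtain ⟨d, rfl⟩ := Nat.exists_eq_add_of_le h
      simp only [add_assoc, y2]
      exact hz.2 d
  · rw [forall_getD_append, forall_getD_append]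
    refine ⟨⟨fun i hi => by rw [y1 i hi, hxu.1 i hi], fun i hi => by rw [y2, hzv.1 i hi]⟩,
      fun i hi => ?_⟩
    rw [List.length_append, add_assoc, y2, hzv.2 i hi]

theorem isSynchronised (ha : IsBlockSeq M P a) (hM : 1 ≤ M) (hP : 2 ≤ P) :
    IsSynchronised (symShift M a) := by
  refine ⟨fun u v hu hv => ?_, syncWord M P, ha.inLang_syncWord hM hP,
    ha.intrinsicallySynchronising_syncWord hM hP⟩
  obtain ⟨S, hS⟩ := ha.hasSpecification hM hP
  obtain ⟨w, -, hw⟩ := hS u v hu hv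
  exact ⟨w, hw⟩

end IsBlockSeq

/-- The value `∑ aᵢ q^{-(i+1)}` of a sequence in base `q`. -/
noncomputable def seqVal (q : ℝ) (a : ℕ → ℕ) : ℝ := ∑' i : ℕ, (a i : ℝ) / q ^ (i + 1)

theorem hasSum_const_div_pow_succ {q : ℝ} (hq : 1 < q) (c : ℝ) :
    HasSum (fun i : ℕ => c / q ^ (i + 1)) (c / (q - 1)) := by
  have h := (hasSum_geometric_of_lt_one (r := q⁻¹) (by positivity) (inv_lt_one_of_one_lt₀ hq)).mul_left
    (c / q)
  have hq1 : q - 1 ≠ 0 := by linarith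
  have hq0 : q ≠ 0 := by linarith
  convert! h using 1
  · funext i
    rw [inv_pow, pow_succ]
    field_simp
  · field_simp

theorem summable_seqVal {M : ℕ} {q : ℝ} (hq : 1 < q) {a : ℕ → ℕ} (ha : memSigma M a) :
    Summable fun i : ℕ => (a i : ℝ) / q ^ (i + 1) := by
  refine Summable.of_nonneg_of_le (fun i => by positivity) (fun i => ?_)
    (hasSum_const_div_pow_succ hq (M : ℝ)).summable
  gcongr
  exact ha i

theorem seqVal_nonneg {q : ℝ} (hq : 1 < q) (a : ℕ → ℕ) : 0 ≤ seqVal q a :=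
  tsum_nonneg fun i => by positivity

theorem seqVal_le {M : ℕ} {q : ℝ} (hq : 1 < q) {a : ℕ → ℕ} (ha : memSigma M a) :
    seqVal q a ≤ M / (q - 1) := by
  rw [← (hasSum_const_div_pow_succ hq (M : ℝ)).tsum_eq]
  refine Summable.tsum_le_tsum (fun i => ?_) (summable_seqVal hq ha)
    (hasSum_const_div_pow_succ hq (M : ℝ)).summable
  gcongr
  exact ha i

theorem seqVal_eq_sum_add {M : ℕ} {q : ℝ} (hq : 1 < q) {a : ℕ → ℕ} (ha : memSigma M a) (n : ℕ) :
    seqVal q a = (∑ i ∈ Finset.range n, (a i : ℝ) / q ^ (i + 1)) +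
      seqVal q (fun i => a (n + i)) / q ^ n := by
  rw [seqVal, ← (summable_seqVal hq ha).sum_add_tsum_nat_add n, seqVal, ← tsum_div_const]
  congr 2
  funext i
  rw [add_comm i n, div_div, ← pow_add]
  congr 2
  ring

theorem seqVal_eq_sum_add_div {M : ℕ} {q : ℝ} (hq : 1 < q) {a : ℕ → ℕ} (ha : memSigma M a)
    (n : ℕ) :
    seqVal q a = (∑ i ∈ Finset.range n, (a i : ℝ) / q ^ (i + 1)) +
      (a n + seqVal q (fun i => a (n + 1 + i))) / q ^ (n + 1) := by
  rw [seqVal_eq_sum_add hq ha (n + 1), Finset.sum_range_succ]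
  ring

theorem div_pow_le_seqVal {M : ℕ} {q : ℝ} (hq : 1 < q) {a : ℕ → ℕ} (ha : memSigma M a) (n : ℕ) :
    (a n : ℝ) / q ^ (n + 1) ≤ seqVal q a :=
  (summable_seqVal hq ha).le_tsum n fun _ _ => by positivity

theorem seqVal_tail_le_one {M : ℕ} {q : ℝ} (hq : 1 < q) {a : ℕ → ℕ} (ha : memSigma M a)
    (hmax : ∀ n, lexLE (fun i => a (n + i)) a) (h1 : seqVal q a = 1) (m : ℕ) :
    seqVal q (fun i => a (m + i)) ≤ 1 := by
  have hq0 : 0 < q := by linarith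
  have hC : 0 ≤ (M : ℝ) / (q - 1) := div_nonneg (by positivity) (by linarith)
  have key : ∀ k m : ℕ, seqVal q (fun i => a (m + i)) ≤ 1 + (M : ℝ) / (q - 1) / q ^ k := by
    intro k
    induction k with
    | zero =>
      intro m
      have := seqVal_le hq (a := fun i => a (m + i)) fun i => ha _
      rw [pow_zero, div_one]
      linarith
    | succ k ih =>
      intro m
      rcases hmax m with h | ⟨n, hn, hlt⟩
      · rw [h, h1]
        have : 0 ≤ (M : ℝ) / (q - 1) / q ^ (k + 1) := by positivity
        linarith
      · replace hn : ∀ i < n, a (m + i) = a i := hn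
        replace hlt : a (m + n) < a n := hlt
        have e1 := seqVal_eq_sum_add_div hq (a := fun i => a (m + i)) (fun i => ha _) n
        have e2 := seqVal_eq_sum_add_div hq ha n
        rw [Finset.sum_congr rfl fun i hi => by rw [hn i (Finset.mem_range.1 hi)]] at e1
        have h3 := ih (m + (n + 1))
        have h4 := seqVal_nonneg hq (fun i => a (n + 1 + i))
        have h5 : ((a (m + n) : ℕ) : ℝ) + 1 ≤ a n := by exact_mod_cast hlt
        simp only [← add_assoc] at e1 h3
        have h6 : ((a (m + n) : ℝ) + seqVal q (fun i => a (m + n + 1 + i))) / q ^ (n + 1) ≤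
            (a n + seqVal q (fun i => a (n + 1 + i))) / q ^ (n + 1) +
              (M : ℝ) / (q - 1) / q ^ k / q ^ (n + 1) := by
          rw [← add_div]
          gcongr ?_ / _
          linarith
        have h7 : (M : ℝ) / (q - 1) / q ^ k / q ^ (n + 1) ≤ (M : ℝ) / (q - 1) / q ^ (k + 1) := by
          rw [div_div _ (q ^ k), ← pow_add]
          gcongr
          · exact hq.le
          · omega
        linarith
  refine ge_of_tendsto' (f := fun k : ℕ => 1 + (M : ℝ) / (q - 1) / q ^ k) (x := Filter.atTop) ?_
    (fun k => key k m)
  have := (tendsto_pow_atTop_nhds_zero_of_lt_one (r := q⁻¹) (by positivity)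
    (inv_lt_one_of_one_lt₀ hq)).const_mul ((M : ℝ) / (q - 1))
  simpa [div_eq_mul_inv] using this.const_add 1

theorem exists_first_ne {a b : ℕ → ℕ} (h : a ≠ b) : ∃ n, (∀ i < n, a i = b i) ∧ a n ≠ b n := by
  have hex : ∃ n, a n ≠ b n := Function.ne_iff.1 h
  exact ⟨Nat.find hex, fun i hi => not_not.1 (Nat.find_min hex hi), Nat.find_spec hex⟩

theorem lexLT_asymm {a b : ℕ → ℕ} (hab : lexLT a b) (hba : lexLT b a) : False := by
  obtain ⟨n, hn, hlt⟩ := hab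
  obtain ⟨m, hm, hlt'⟩ := hba
  rcases lt_trichotomy n m with h | rfl | h
  · have := hm n h; omega
  · omega
  · have := hn m h; omega

theorem lexLE_antisymm {a b : ℕ → ℕ} (hab : lexLE a b) (hba : lexLE b a) : a = b := by
  rcases hab with rfl | hab
  · rfl
  · rcases hba with rfl | hba
    · rfl
    · exact (lexLT_asymm hab hba).elim

theorem qg_eq {M : ℕ} {q : ℝ} (hq : 1 < q) {a : ℕ → ℕ} (ha : memSigma M a)
    (hinf : ∀ n, ∃ m ≥ n, a m ≠ 0) (hmax : ∀ n, lexLE (fun i => a (n + i)) a)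
    (h1 : seqVal q a = 1) : qg M q = a := by
  have hq0 : 0 < q := by linarith
  have hqa : IsQuasiGreedy M q a := by
    refine ⟨ha, hinf, h1, fun b hb hbinf hb1 => ?_⟩
    change seqVal q b = 1 at hb1
    by_contra hcon
    have hne : a ≠ b := fun h => hcon (Or.inl h.symm)
    obtain ⟨n, hn, hne⟩ := exists_first_ne hne
    rcases lt_or_gt_of_ne hne with hlt | hlt
    · have e1 := seqVal_eq_sum_add_div hq ha n
      have e2 := seqVal_eq_sum_add_div hq hb n
      rw [Finset.sum_congr rfl fun i hi => by rw [hn i (Finset.mem_range.1 hi)]] at e1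
      have h3 := seqVal_tail_le_one hq ha hmax h1 (n + 1)
      have h4 : 0 < seqVal q (fun i => b (n + 1 + i)) := by
        obtain ⟨m, hm, hm0⟩ := hbinf (n + 1)
        obtain ⟨d, rfl⟩ := Nat.exists_eq_add_of_le hm
        refine lt_of_lt_of_le ?_ (div_pow_le_seqVal hq (M := M) (fun i => hb _) d)
        have : 0 < b (n + 1 + d) := Nat.pos_of_ne_zero hm0
        positivity
      have h5 : ((a n : ℕ) : ℝ) + 1 ≤ b n := by exact_mod_cast hlt
      have h6 : (a n + seqVal q (fun i => a (n + 1 + i))) / q ^ (n + 1) <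
          (b n + seqVal q (fun i => b (n + 1 + i))) / q ^ (n + 1) := by
        gcongr ?_ / _
        linarith
      linarith
    · exact hcon (Or.inr ⟨n, fun i hi => (hn i hi).symm, hlt⟩)
  have hex : ∃ a, IsQuasiGreedy M q a := ⟨a, hqa⟩
  rw [qg, dif_pos hex]
  have hc := hex.choose_spec
  exact lexLE_antisymm (hqa.2.2.2 _ hc.1 hc.2.1 hc.2.2.1) (hc.2.2.2 _ ha hinf h1)

theorem abs_pow_sub_pow_le_mul {u v c : ℝ} (hu : 0 ≤ u) (hv : 0 ≤ v) (huc : u ≤ c) (hvc : v ≤ c)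
    (n : ℕ) : |u ^ (n + 1) - v ^ (n + 1)| ≤ (n + 1) * c ^ n * |u - v| := by
  have h := abs_pow_sub_pow_le u v (n + 1)
  rw [abs_of_nonneg hu, abs_of_nonneg hv, Nat.add_sub_cancel] at h
  refine h.trans ?_
  have hpow : max u v ^ n ≤ c ^ n :=
    pow_le_pow_left₀ (le_max_of_le_left hu) (max_le huc hvc) n
  push_cast
  calc |u - v| * (n + 1) * max u v ^ n ≤ |u - v| * (n + 1) * c ^ n := by gcongr
    _ = _ := by ring

/-- A Lipschitz constant for `q ↦ seqVal q a` on `[3/2, ∞)`. -/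
theorem exists_lipschitz_seqVal (M : ℕ) : ∃ C : ℝ, 0 < C ∧ ∀ a, memSigma M a → ∀ q q' : ℝ,
    3 / 2 ≤ q → 3 / 2 ≤ q' → |seqVal q a - seqVal q' a| ≤ C * |q - q'| := by
  have hs : Summable fun n : ℕ => (M : ℝ) * ((n + 1) * (2 / 3 : ℝ) ^ n) := by
    refine Summable.mul_left _ ?_
    have h1 := summable_pow_mul_geometric_of_norm_lt_one 1 (r := (2 / 3 : ℝ)) (by norm_num)
    have h2 := summable_geometric_of_lt_one (r := (2 / 3 : ℝ)) (by norm_num) (by norm_num)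
    refine (h1.add h2).congr fun n => ?_
    rw [pow_one]
    ring
  refine ⟨(∑' n : ℕ, (M : ℝ) * ((n + 1) * (2 / 3 : ℝ) ^ n)) + 1,
    by have : 0 ≤ ∑' n : ℕ, (M : ℝ) * ((n + 1) * (2 / 3 : ℝ) ^ n) :=
        tsum_nonneg fun n => by positivity
       linarith, fun a ha q q' hq hq' => ?_⟩
  have hq0 : 0 < q := by linarith
  have hq0' : 0 < q' := by linarith
  have huv : |q⁻¹ - q'⁻¹| ≤ |q - q'| := by
    rw [inv_sub_inv hq0.ne' hq0'.ne', abs_div, abs_sub_comm, abs_of_pos (mul_pos hq0 hq0')]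
    refine div_le_self (abs_nonneg _) ?_
    nlinarith
  have hinv : ∀ p : ℝ, 3 / 2 ≤ p → p⁻¹ ≤ 2 / 3 := fun p hp => by
    rw [show (2 / 3 : ℝ) = (3 / 2)⁻¹ by norm_num]
    gcongr
  have hterm : ∀ n : ℕ, ‖(a n : ℝ) / q ^ (n + 1) - (a n : ℝ) / q' ^ (n + 1)‖ ≤
      (M : ℝ) * ((n + 1) * (2 / 3 : ℝ) ^ n) * |q - q'| := fun n => by
    have h := abs_pow_sub_pow_le_mul (u := q⁻¹) (v := q'⁻¹) (by positivity) (by positivity)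
      (hinv q hq) (hinv q' hq') n
    rw [div_eq_mul_inv, div_eq_mul_inv, ← mul_sub, ← inv_pow, ← inv_pow, Real.norm_eq_abs, abs_mul,
      Nat.abs_cast, mul_assoc]
    gcongr
    · exact ha n
    · exact h.trans (by gcongr)
  have hs' := hs.mul_right |q - q'|
  rw [seqVal, seqVal, ← (summable_seqVal (by linarith) ha).tsum_sub
    (summable_seqVal (by linarith) ha), ← Real.norm_eq_abs]
  refine (tsum_of_norm_bounded hs'.hasSum hterm).trans ?_
  rw [tsum_mul_right]
  gcongr
  linarith

namespace IsBlockSeq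

variable {M P : ℕ} {a : ℕ → ℕ}

theorem qg_eq_of_seqVal (ha : IsBlockSeq M P a) (hM : 1 ≤ M) (hP : 2 ≤ P) {q : ℝ} (hq : 1 < q)
    (h1 : seqVal q a = 1) : qg M q = a := by
  refine qg_eq hq ha.le (fun n => ?_)
    (fun n => ((mem_symShift_iff.1 (ha.mem_symShift hM hP)).2 n).2) h1
  obtain ⟨-, j, -, hj⟩ := ha.exists_window hP (i := n + 1) (by omega)
  exact ⟨n + 1 + j, by omega, by omega⟩

theorem exists_base (ha : IsBlockSeq M P a) (hM : 1 ≤ M) :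
    ∃ q : ℝ, 3 / 2 ≤ q ∧ q ≤ M + 1 ∧ seqVal q a = 1 := by
  have hM' : (1 : ℝ) ≤ M := by exact_mod_cast hM
  obtain ⟨C, hC, hlip⟩ := exists_lipschitz_seqVal M
  have hcont : ContinuousOn (fun q => seqVal q a) (Set.Icc (3 / 2) ((M : ℝ) + 1)) := by
    have : LipschitzOnWith C.toNNReal (fun q => seqVal q a) (Set.Icc (3 / 2) ((M : ℝ) + 1)) := by
      refine LipschitzOnWith.of_dist_le_mul fun x hx y hy => ?_
      rw [Real.coe_toNNReal _ hC.le]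
      exact hlip a ha.le x y hx.1 hy.1
    exact this.continuousOn
  have h := intermediate_value_Icc' (by linarith) hcont
  have hmem : (1 : ℝ) ∈ Set.Icc (seqVal ((M : ℝ) + 1) a) (seqVal (3 / 2) a) := by
    constructor
    · refine (seqVal_le (by linarith) ha.le).trans (le_of_eq ?_)
      rw [add_sub_cancel_right, div_self (by linarith)]
    · have h0 := seqVal_eq_sum_add (q := 3 / 2) (by norm_num) ha.le 2
      have h1 := seqVal_nonneg (q := 3 / 2) (by norm_num) (fun i => a (2 + i))
      rw [Finset.sum_range_succ, Finset.sum_range_one, ha.head 0 (by omega),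
        ha.head 1 (by omega)] at h0
      have h2 : 0 ≤ seqVal (3 / 2) (fun i => a (2 + i)) / (3 / 2) ^ 2 := by positivity
      rw [h0]
      norm_num
      norm_num at h2
      linarith
  obtain ⟨q, hq, hq1⟩ := h hmem
  exact ⟨q, hq.1, hq.2, hq1⟩

end IsBlockSeq

/-- If two bases have expansions of block form, then their distance is controlled from below by
the first place where the expansions differ. -/
theorem exists_separation {M P : ℕ} (hM : 1 ≤ M) (hP : 2 ≤ P) : ∃ D : ℝ, 0 < D ∧
    ∀ a a' : ℕ → ℕ, IsBlockSeq M P a → IsBlockSeq M P a' → ∀ q q' : ℝ, 3 / 2 ≤ q → 3 / 2 ≤ q' →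
    q ≤ M + 1 → q' ≤ M + 1 → seqVal q a = 1 → seqVal q' a' = 1 →
    ∀ n, (∀ i < n, a i = a' i) → a n ≠ a' n → D / ((M : ℝ) + 1) ^ n ≤ |q - q'| := by
  obtain ⟨C, hC, hlip⟩ := exists_lipschitz_seqVal M
  have key : ∀ a a' : ℕ → ℕ, IsBlockSeq M P a → IsBlockSeq M P a' → ∀ q q' : ℝ,
      3 / 2 ≤ q → 3 / 2 ≤ q' → q ≤ M + 1 → seqVal q a = 1 → seqVal q' a' = 1 →
      ∀ n, (∀ i < n, a i = a' i) → a n < a' n →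
      1 / ((M : ℝ) + 1) ^ (P + 4) / ((M : ℝ) + 1) ^ (n + 1) ≤ C * |q - q'| := by
    intro a a' ha ha' q q' hq hq' hqM h1 h1' n hn hlt
    have hq1 : 1 < q := by linarith
    have hq0 : 0 < q := by linarith
    refine le_trans ?_ (hlip a' ha'.le q q' hq hq')
    rw [h1']
    refine le_trans ?_ (le_abs_self _)
    have e1 := seqVal_eq_sum_add_div hq1 ha.le n
    have e2 := seqVal_eq_sum_add_div hq1 ha'.le n
    rw [Finset.sum_congr rfl fun i hi => by rw [hn i (Finset.mem_range.1 hi)], h1] at e1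
    have h3 := seqVal_tail_le_one hq1 ha.le
      (fun n => ((mem_symShift_iff.1 (ha.mem_symShift hM hP)).2 n).2) h1 (n + 1)
    have h5 : ((a n : ℕ) : ℝ) + 1 ≤ a' n := by exact_mod_cast hlt
    obtain ⟨-, j, hj, hjM⟩ := ha'.exists_window hP (i := n + 1) (by omega)
    have h4 : 1 / ((M : ℝ) + 1) ^ (P + 4) ≤ seqVal q (fun i => a' (n + 1 + i)) := by
      refine le_trans ?_ (div_pow_le_seqVal hq1 (M := M) (fun i => ha'.le _) j)
      rw [hjM]
      gcongr
      · exact_mod_cast hM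
      · calc q ^ (j + 1) ≤ q ^ (P + 4) := pow_le_pow_right₀ hq1.le (by omega)
          _ ≤ _ := by gcongr
    have h6 : (a n + seqVal q (fun i => a (n + 1 + i))) / q ^ (n + 1) +
        1 / ((M : ℝ) + 1) ^ (P + 4) / q ^ (n + 1) ≤
        (a' n + seqVal q (fun i => a' (n + 1 + i))) / q ^ (n + 1) := by
      rw [← add_div]
      gcongr
      linarith
    have h7 : 1 / ((M : ℝ) + 1) ^ (P + 4) / ((M : ℝ) + 1) ^ (n + 1) ≤
        1 / ((M : ℝ) + 1) ^ (P + 4) / q ^ (n + 1) := by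
      gcongr
    linarith
  refine ⟨1 / ((M : ℝ) + 1) ^ (P + 4) / ((M : ℝ) + 1) / C, by positivity, ?_⟩
  intro a a' ha ha' q q' hq hq' hqM hqM' h1 h1' n hn hne
  have hmain : 1 / ((M : ℝ) + 1) ^ (P + 4) / ((M : ℝ) + 1) ^ (n + 1) ≤ C * |q - q'| := by
    rcases lt_or_gt_of_ne hne with hlt | hlt
    · exact key a a' ha ha' q q' hq hq' hqM h1 h1' n hn hlt
    · rw [abs_sub_comm]
      exact key a' a ha' ha q' q hq' hq hqM' h1' h1 n (fun i hi => (hn i hi).symm) hlt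
  rw [← div_le_iff₀' hC] at hmain
  refine le_trans (le_of_eq ?_) hmain
  rw [pow_succ]
  field_simp
  ring

/-- The block sequence with free digits given by `b`, in blocks of `L` free digits. -/
def blockSeq (M L : ℕ) (b : ℕ → ℕ) (i : ℕ) : ℕ :=
  if i < L + 2 + 4 then M
  else if (i - (L + 2 + 4)) % (L + 2) = 0 then 0
  else if (i - (L + 2 + 4)) % (L + 2) = 1 then M
  else b ((i - (L + 2 + 4)) / (L + 2) * L + ((i - (L + 2 + 4)) % (L + 2) - 2))

/-- The place of the `i`-th free digit in `blockSeq`. -/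
def freePos (L i : ℕ) : ℕ := L + 2 + 4 + (L + 2) * (i / L) + (i % L + 2)

theorem isBlockSeq_blockSeq {M L : ℕ} {b : ℕ → ℕ} (hb : memSigma M b) :
    IsBlockSeq M (L + 2) (blockSeq M L b) where
  le i := by
    unfold blockSeq
    split_ifs
    · exact le_rfl
    · exact Nat.zero_le _
    · exact le_rfl
    · exact hb _
  head i hi := if_pos hi
  zero t := by
    have h : L + 2 + 4 + (L + 2) * t - (L + 2 + 4) = (L + 2) * t := by omega
    rw [blockSeq, if_neg (by omega), h, Nat.mul_mod_right, if_pos rfl]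
  top t := by
    have h : L + 2 + 4 + (L + 2) * t + 1 - (L + 2 + 4) = (L + 2) * t + 1 := by omega
    have h1 : ((L + 2) * t + 1) % (L + 2) = 1 := by
      rw [Nat.mul_add_mod, Nat.mod_eq_of_lt (by omega)]
    rw [blockSeq, if_neg (by omega), h, h1, if_neg one_ne_zero, if_pos rfl]

theorem blockSeq_freePos {M L : ℕ} (hL : 1 ≤ L) (b : ℕ → ℕ) (i : ℕ) :
    blockSeq M L b (freePos L i) = b i := by
  have hlt : i % L < L := Nat.mod_lt _ hL
  have h : freePos L i - (L + 2 + 4) = (L + 2) * (i / L) + (i % L + 2) := by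
    rw [freePos]; omega
  have h1 : ((L + 2) * (i / L) + (i % L + 2)) % (L + 2) = i % L + 2 := by
    rw [Nat.mul_add_mod, Nat.mod_eq_of_lt (by omega)]
  have h2 : ((L + 2) * (i / L) + (i % L + 2)) / (L + 2) = i / L := by
    rw [Nat.mul_add_div (by omega), Nat.div_eq_of_lt (show i % L + 2 < L + 2 by omega), add_zero]
  rw [blockSeq, if_neg (by rw [freePos]; omega), h, h1, h2, if_neg (by omega), if_neg (by omega),
    Nat.add_sub_cancel, Nat.div_add_mod']

theorem freePos_lt {L n i : ℕ} (hL : 1 ≤ L) (hi : i < (n - (L + 8)) * L / (L + 2)) :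
    freePos L i < n := by
  have h1 : (i + 1) * (L + 2) ≤ (n - (L + 8)) * L := (Nat.le_div_iff_mul_le (by omega)).1 hi
  have h2 := Nat.div_add_mod i L
  have h3 : (i + 2 * (i / L)) * L < (n - (L + 8)) * L := by
    have h4 := Nat.mul_div_le i L
    have h5 : (i + 2 * (i / L)) * L = i * L + 2 * (L * (i / L)) := by ring
    have h6 : (i + 1) * (L + 2) = i * L + 2 * i + L + 2 := by ring
    omega
  have h4 := Nat.lt_of_mul_lt_mul_right h3
  rw [freePos, add_mul]
  omega

theorem dimH_le_of_holder {s : Set ℝ} {f : ℝ → ℝ} {r : NNReal} (hr : 0 < r) {C : ℝ} (hC : 0 ≤ C)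
    (hf : ∀ x ∈ s, ∀ y ∈ s, |f x - f y| ≤ C * |x - y| ^ (r : ℝ)) (hsurj : Set.Ico 0 1 ⊆ f '' s) :
    (r : ENNReal) ≤ dimH s := by
  have hh : HolderOnWith C.toNNReal r f s := by
    intro x hx y hy
    rw [edist_dist, edist_dist, Real.dist_eq, Real.dist_eq,
      ENNReal.ofReal_rpow_of_nonneg (abs_nonneg _) r.coe_nonneg, ← ENNReal.ofReal_coe_nnreal,
      Real.coe_toNNReal _ hC, ← ENNReal.ofReal_mul hC]
    exact ENNReal.ofReal_le_ofReal (hf x hx y hy)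
  have h1 : dimH (Set.Ico (0 : ℝ) 1) = 1 := by
    rw [Real.dimH_of_nonempty_interior, Module.finrank_self, Nat.cast_one]
    rw [interior_Ico]
    exact ⟨1 / 2, by norm_num, by norm_num⟩
  have h2 := (dimH_mono hsurj).trans (hh.dimH_image_le hr)
  rw [h1, ENNReal.le_div_iff_mul_le (Or.inl (by exact_mod_cast hr.ne')) (Or.inl ENNReal.coe_ne_top),
    one_mul] at h2
  exact h2

theorem le_dimH_blockBases {M L : ℕ} (hM : 1 ≤ M) (hL : 1 ≤ L) :
    (((L : NNReal) / (L + 2) : NNReal) : ENNReal) ≤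
      dimH {q : ℝ | 3 / 2 ≤ q ∧ q ≤ M + 1 ∧
        ∃ b, memSigma M b ∧ seqVal q (blockSeq M L b) = 1} := by
  obtain ⟨D, hD, hsep⟩ := exists_separation (P := L + 2) hM (by omega)
  have hB : (1 : ℝ) ≤ (M : ℝ) + 1 := by simp
  have hB0 : (0 : ℝ) < (M : ℝ) + 1 := by linarith
  have hr : 0 < (L : NNReal) / (L + 2) := by
    have : (0 : NNReal) < L := by exact_mod_cast hL
    positivity
  obtain ⟨r, hr'⟩ : ∃ r : ℝ, r = (((L : NNReal) / (L + 2) : NNReal) : ℝ) := ⟨_, rfl⟩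
  have hrL : r * (L + 2) = L := by
    rw [hr']
    push_cast
    field_simp
  refine dimH_le_of_holder
    (f := fun q => Real.ofDigits fun i => Fin.ofNat (M + 1) (qg M q (freePos L i)))
    (C := ((M : ℝ) + 1) ^ (L + 9) * (1 / D) ^ r) hr (by positivity) ?_ ?_
  · rintro q ⟨hq, hqM, b, hb, h1⟩ q' ⟨hq', hqM', b', hb', h1'⟩
    have ha := isBlockSeq_blockSeq (L := L) hb
    have ha' := isBlockSeq_blockSeq (L := L) hb'
    rw [ha.qg_eq_of_seqVal hM (by omega) (by linarith) h1,
      ha'.qg_eq_of_seqVal hM (by omega) (by linarith) h1', ← hr']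
    by_cases hne : blockSeq M L b = blockSeq M L b'
    · rw [hne, sub_self, abs_zero]
      positivity
    obtain ⟨n, hn, hne⟩ := exists_first_ne hne
    have hdist := hsep _ _ ha ha' q q' hq hq' hqM hqM' h1 h1' n hn hne
    obtain ⟨k, hk⟩ : ∃ k, k = (n - (L + 8)) * L / (L + 2) := ⟨_, rfl⟩
    refine (Real.abs_ofDigits_sub_ofDigits_le (n := k) fun i hi => ?_).trans ?_
    · rw [hn _ (freePos_lt hL (hk ▸ hi))]
    have hnk : n * L ≤ (k + (L + 9)) * (L + 2) := by
      have h2 : (n - (L + 8)) * L < (k + 1) * (L + 2) := by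
        rw [hk]
        exact (Nat.div_lt_iff_lt_mul (by omega)).1 (Nat.lt_succ_self _)
      have h3 : n * L ≤ (n - (L + 8) + (L + 8)) * L := Nat.mul_le_mul_right _ (by omega)
      nlinarith
    have hnr : (n : ℝ) * r ≤ (k : ℝ) + ((L + 9 : ℕ) : ℝ) := by
      have h4 : (n : ℝ) * L ≤ ((k : ℝ) + ((L + 9 : ℕ) : ℝ)) * (L + 2) := by exact_mod_cast hnk
      rw [show (n : ℝ) * L = n * r * (L + 2) by rw [mul_assoc, hrL]] at h4
      exact le_of_mul_le_mul_right h4 (by positivity)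
    have hr0 : 0 ≤ r := hr' ▸ NNReal.coe_nonneg _
    have h5 : (1 / ((M : ℝ) + 1) ^ n) ^ r ≤ (1 / D) ^ r * |q - q'| ^ r := by
      rw [← Real.mul_rpow (by positivity) (abs_nonneg _)]
      refine Real.rpow_le_rpow (by positivity) ?_ hr0
      rw [div_mul_eq_mul_div, one_mul, le_div_iff₀ hD]
      refine le_trans (le_of_eq ?_) hdist
      ring
    have h6 : (((M + 1 : ℕ) : ℝ) ^ k)⁻¹ ≤
        ((M : ℝ) + 1) ^ (L + 9) * (1 / ((M : ℝ) + 1) ^ n) ^ r := by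
      push_cast
      rw [one_div, ← Real.rpow_natCast _ n, Real.inv_rpow (by positivity),
        ← Real.rpow_mul hB0.le, ← div_eq_mul_inv, le_div_iff₀ (by positivity), inv_mul_le_iff₀
        (by positivity), ← pow_add, ← Real.rpow_natCast]
      refine Real.rpow_le_rpow_of_exponent_le hB ?_
      push_cast at hnr ⊢
      exact hnr
    calc _ ≤ _ := h6
      _ ≤ ((M : ℝ) + 1) ^ (L + 9) * ((1 / D) ^ r * |q - q'| ^ r) := by gcongr
      _ = _ := by ring
  · intro y hy
    have hb : memSigma M fun i => (Real.digits y (M + 1) i : ℕ) :=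
      fun i => Nat.lt_succ_iff.1 (Real.digits y (M + 1) i).2
    have ha := isBlockSeq_blockSeq (L := L) hb
    obtain ⟨q, hq, hqM, h1⟩ := ha.exists_base hM
    refine ⟨q, ⟨hq, hqM, _, hb, h1⟩, ?_⟩
    simp only [ha.qg_eq_of_seqVal hM (by omega) (by linarith) h1, blockSeq_freePos hL,
      Fin.ofNat_eq_cast, Fin.cast_val_eq_self]
    exact Real.ofDigits_digits (by omega) hy

theorem dimH_eq_one_of_blockBases_subset {M : ℕ} (hM : 1 ≤ M) {s : Set ℝ}
    (hs : ∀ L ≥ 1, ∀ q : ℝ, 1 < q → q ≤ M + 1 → IsBlockSeq M (L + 2) (qg M q) → q ∈ s) :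
    dimH s = 1 := by
  refine le_antisymm ((dimH_mono (Set.subset_univ s)).trans_eq Real.dimH_univ) ?_
  have h : ∀ n : ℕ, ((((n + 1 : ℕ) : NNReal) / ((n + 1 : ℕ) + 2) : NNReal) : ENNReal) ≤ dimH s := by
    intro n
    refine (le_dimH_blockBases hM (by omega)).trans (dimH_mono ?_)
    rintro q ⟨hq, hqM, b, hb, h1⟩
    have ha := isBlockSeq_blockSeq (L := n + 1) hb
    refine hs (n + 1) (by omega) q (by linarith) hqM ?_
    rwa [ha.qg_eq_of_seqVal hM (by omega) (by linarith) h1]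
  refine le_of_tendsto' (x := Filter.atTop) (f := fun n : ℕ =>
    ((((n + 1 : ℕ) : NNReal) / ((n + 1 : ℕ) + 2) : NNReal) : ENNReal)) ?_ h
  rw [← ENNReal.coe_one, ENNReal.tendsto_coe]
  exact (tendsto_natCast_div_add_atTop (2 : NNReal)).comp (Filter.tendsto_add_atTop_nat 1)

/-- The classes `C3` (specification) and `C4` (synchronised) have full
Hausdorff dimension. -/
theorem dimH_specification_and_synchronised (M : ℕ) (hM : 1 ≤ M) :
    dimH {q : ℝ | memVL M q ∧ HasSpecification (Vq M q)} = 1 ∧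
      dimH {q : ℝ | memVL M q ∧ IsSynchronised (Vq M q)} = 1 := by
  constructor
  all_goals
    refine dimH_eq_one_of_blockBases_subset hM fun L _ q hq hqM ha => ⟨⟨hq, hqM, ?_⟩, ?_⟩
    · exact ha.mem_symShift hM (by omega)
  · exact ha.hasSpecification hM (by omega)
  · exact ha.isSynchronised hM (by omega)
end

section
/- Let q ∈ U̅ and let (q_m^-)_{m≥1} be the natural approximation from below of q. Then for every k ∈ ℕ there exists J ∈ ℕ such that for every m ≥ J one has B_k(V_q) = B_k(V_{q_m^-}) = B_k(V_{q_J^-}), where B_k denotes the set of admissible words of length k. -/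
open Classical

theorem lexLE.exists_lt {x y : ℕ → ℕ} (h : lexLE x y) {e : ℕ} (he : x e ≠ y e) :
    ∃ d ≤ e, (∀ j < d, x j = y j) ∧ x d < y d := by
  rcases h with rfl | ⟨d, hd, hlt⟩
  · exact absurd rfl he
  · refine ⟨d, ?_, hd, hlt⟩
    by_contra hcon
    exact he (hd e (by omega))

theorem lexLE.antisymm {x y : ℕ → ℕ} (h : lexLE x y) (h' : lexLE y x) : x = y := by
  rcases h with rfl | ⟨d, hd, hlt⟩
  · rfl
  · obtain ⟨e, hed, he, hlt'⟩ := h'.exists_lt (e := d) (by omega)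
    rcases Nat.lt_or_ge e d with h1 | h1
    · have := hd e h1
      omega
    · have : e = d := by omega
      subst this
      omega

theorem lexLE_or_lexLT (x y : ℕ → ℕ) : lexLE x y ∨ lexLT y x := by
  by_cases hxy : x = y
  · exact Or.inl (Or.inl hxy)
  · have hex : ∃ n, x n ≠ y n := Function.ne_iff.mp hxy
    have hmin : ∀ i < Nat.find hex, x i = y i := fun i hi => by
      simpa using Nat.find_min hex hi
    rcases lt_or_gt_of_ne (Nat.find_spec hex) with h | h
    · exact Or.inl (Or.inr ⟨_, hmin, h⟩)
    · exact Or.inr ⟨_, fun i hi => (hmin i hi).symm, h⟩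

/-! ### Languages of symmetric shifts -/

/-- The set of sequences all of whose shifts lie between `ā` and `a`. -/
def symmShift (M : ℕ) (a : ℕ → ℕ) : Set (ℕ → ℕ) :=
  {x | memSigma M x ∧ ∀ n : ℕ, lexLE (reflSeq M a) (shift^[n] x) ∧ lexLE (shift^[n] x) a}

theorem lexLE.reflSeq {M : ℕ} {x y : ℕ → ℕ} (hy : memSigma M y) (h : lexLE x y) :
    lexLE (reflSeq M y) (reflSeq M x) := by
  rcases h with rfl | ⟨d, hd, hlt⟩
  · exact Or.inl rfl
  · refine Or.inr ⟨d, fun i hi => ?_, ?_⟩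
    · simp [_root_.reflSeq, hd i hi]
    · have := hy d
      simp only [_root_.reflSeq]
      omega

theorem shift_iterate_reflSeq (M : ℕ) (x : ℕ → ℕ) (n : ℕ) :
    shift^[n] (reflSeq M x) = reflSeq M (shift^[n] x) := by
  funext i
  simp [shift_iterate_apply, reflSeq]

theorem memV.mem_symmShift {M : ℕ} {b : ℕ → ℕ} (hb : memV M b) : b ∈ symmShift M b := hb

theorem memV.reflSeq_mem_symmShift {M : ℕ} {b : ℕ → ℕ} (hb : memV M b) :
    reflSeq M b ∈ symmShift M b := by
  refine ⟨fun i => Nat.sub_le _ _, fun n => ?_⟩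
  have hs : memSigma M (shift^[n] b) := fun i => by
    rw [shift_iterate_apply]
    exact hb.1 _
  rw [shift_iterate_reflSeq]
  refine ⟨(hb.2 n).2.reflSeq hb.1, ?_⟩
  have := (hb.2 n).1.reflSeq hs
  rwa [reflSeq_reflSeq hb.1] at this

theorem Bn_symmShift_subset {M k : ℕ} {a b : ℕ → ℕ} (hb : memV M b)
    (hab : ∀ i < k, a i = b i) : Bn (symmShift M a) k ⊆ Bn (symmShift M b) k := by
  rintro w ⟨rfl, x, ⟨hxM, hx⟩, s, hs⟩
  set u := shift^[s] x with hu
  have huM : memSigma M u := fun i => by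
    rw [hu, shift_iterate_apply]
    exact hxM _
  have hux : ∀ n, lexLE (reflSeq M a) (shift^[n] u) ∧ lexLE (shift^[n] u) a := fun n => by
    rw [hu, ← Function.iterate_add_apply]
    exact hx _
  have huw : ∀ i < w.length, u i = w.getD i 0 := fun i hi => by
    rw [hu, shift_iterate_apply, hs i hi]
  have hex : ∃ i, ∃ c ∈ ({a, reflSeq M a} : Set (ℕ → ℕ)),
      ∀ j, i + j < w.length → u (i + j) = c j :=
    ⟨w.length, a, by simp, fun j hj => by omega⟩
  obtain ⟨i, hi, hmin⟩ : ∃ i, (∃ c ∈ ({a, reflSeq M a} : Set (ℕ → ℕ)),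
      ∀ j, i + j < w.length → u (i + j) = c j) ∧ ∀ i' < i, ¬ ∃ c ∈ ({a, reflSeq M a} : Set (ℕ → ℕ)),
      ∀ j, i' + j < w.length → u (i' + j) = c j :=
    ⟨Nat.find hex, Nat.find_spec hex, fun _ h => Nat.find_min hex h⟩
  obtain ⟨z, hz, hzu⟩ : ∃ z ∈ symmShift M b, ∀ j, i + j < w.length → u (i + j) = z j := by
    obtain ⟨c, rfl | rfl, hc⟩ := hi
    · exact ⟨b, hb.mem_symmShift, fun j hj => (hc j hj).trans (hab j (by omega))⟩
    · refine ⟨reflSeq M b, hb.reflSeq_mem_symmShift, fun j hj => (hc j hj).trans ?_⟩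
      simp [reflSeq, hab j (by omega)]
  set y : ℕ → ℕ := fun n => if n < i then u n else z (n - i) with hy
  have hyu : ∀ n < w.length, y n = u n := fun n hn => by
    by_cases h : n < i
    · simp [hy, h]
    · simp only [hy, h, if_false]
      rw [← hzu _ (by omega)]
      congr 1
      omega
  refine ⟨rfl, y, ⟨fun n => ?_, fun n => ?_⟩, 0, fun j hj => ?_⟩
  · by_cases h : n < i
    · simpa [hy, h] using huM n
    · simpa [hy, h] using hz.1 (n - i)
  · by_cases h : n < i
    · have hno := hmin n h
      push Not at hno
      obtain ⟨e₁, he₁, hne₁⟩ := hno a (by simp)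
      obtain ⟨e₂, he₂, hne₂⟩ := hno (reflSeq M a) (by simp)
      obtain ⟨d₁, hd₁, heq₁, hlt₁⟩ := (hux n).2.exists_lt (e := e₁)
        (by rwa [shift_iterate_apply])
      obtain ⟨d₂, hd₂, heq₂, hlt₂⟩ := (hux n).1.exists_lt (e := e₂)
        (by rw [shift_iterate_apply]; exact hne₂.symm)
      simp only [shift_iterate_apply, reflSeq] at heq₁ hlt₁ heq₂ hlt₂
      refine ⟨Or.inr ⟨d₂, fun j hj => ?_, ?_⟩, Or.inr ⟨d₁, fun j hj => ?_, ?_⟩⟩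
      · rw [shift_iterate_apply, hyu _ (by omega), ← heq₂ j hj, reflSeq, hab j (by omega)]
      · rw [shift_iterate_apply, hyu _ (by omega), reflSeq, ← hab _ (by omega)]
        exact hlt₂
      · rw [shift_iterate_apply, hyu _ (by omega), heq₁ j hj, hab j (by omega)]
      · rw [shift_iterate_apply, hyu _ (by omega), ← hab _ (by omega)]
        exact hlt₁
    · have : shift^[n] y = shift^[n - i] z := by
        funext j
        have h' : ¬ n + j < i := by omega
        simp only [shift_iterate_apply, hy, h', if_false]
        congr 1
        omega
      rw [this]
      exact hz.2 _
  · rw [zero_add, hyu j hj, huw j hj]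

theorem Bn_symmShift_eq {M k : ℕ} {a b : ℕ → ℕ} (ha : memV M a) (hb : memV M b)
    (hab : ∀ i < k, a i = b i) : Bn (symmShift M a) k = Bn (symmShift M b) k :=
  (Bn_symmShift_subset hb hab).antisymm (Bn_symmShift_subset ha fun i hi => (hab i hi).symm)

/-! ### Periodic truncations lying in `V` -/

theorem exists_forall_reflected_prefix_lt {M : ℕ} {a : ℕ → ℕ} (haM : memSigma M a)
    (hlow : ∀ n, lexLT (reflSeq M a) (shift^[n] a)) (hup : ∀ n, lexLE (shift^[n] a) a) (K : ℕ) :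
    ∃ m ≥ K, ∀ k < m, ∃ d, k + d < m ∧ (∀ j < d, a (k + j) = M - a j) ∧ M - a d < a (k + d) := by
  have hlow' : ∀ k, ∃ d, (∀ j < d, a (k + j) = M - a j) ∧ M - a d < a (k + d) := fun k => by
    obtain ⟨d, hd, hlt⟩ := hlow k
    simp only [shift_iterate_apply, reflSeq] at hd hlt
    exact ⟨d, fun j hj => (hd j hj).symm, hlt⟩
  choose D hD hDlt using hlow'
  have hex : ∃ m, K ≤ m ∧ ∀ k < K, k + D k < m := by
    refine ⟨K + (Finset.range K).sup D + K + 1, by omega, fun k hk => ?_⟩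
    have := Finset.le_sup (f := D) (Finset.mem_range.2 hk)
    omega
  obtain ⟨m, ⟨hKm, hm⟩, hmin⟩ : ∃ m, (K ≤ m ∧ ∀ k < K, k + D k < m) ∧
      ∀ m' < m, ¬ (K ≤ m' ∧ ∀ k < K, k + D k < m') :=
    ⟨Nat.find hex, Nat.find_spec hex, fun _ h => Nat.find_min hex h⟩
  refine ⟨m, hKm, fun i hi => ?_⟩
  rcases Nat.lt_or_ge i K with hiK | hiK
  · exact ⟨D i, hm i hiK, hD i, hDlt i⟩
  have hno := hmin (m - 1) (by omega)
  push Not at hno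
  obtain ⟨k, hk, hkD⟩ := hno (by omega)
  have hkD' : k + D k = m - 1 := by
    have := hm k hk
    omega
  have hmid : ∀ j, i + j < m - 1 → a (i + j) = M - a (i - k + j) := fun j hj => by
    have := hD k (i - k + j) (by omega)
    rwa [show k + (i - k + j) = i + j by omega] at this
  have hlast : M - a (i - k + (m - 1 - i)) < a (i + (m - 1 - i)) := by
    have := hDlt k
    rw [hkD', show D k = i - k + (m - 1 - i) by omega] at this
    rwa [show i + (m - 1 - i) = m - 1 by omega]
  by_cases hall : ∀ j < m - 1 - i, a (i - k + j) = a j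
  · refine ⟨m - 1 - i, by omega, fun j hj => ?_, ?_⟩
    · rw [hmid j (by omega), hall j hj]
    · have : a (i - k + (m - 1 - i)) ≤ a (m - 1 - i) := by
        by_contra hcon
        obtain ⟨d, hd, hd', hlt⟩ := (hup (i - k)).exists_lt (e := m - 1 - i)
          (by rw [shift_iterate_apply]; omega)
        rw [shift_iterate_apply] at hlt
        rcases Nat.lt_or_ge d (m - 1 - i) with h | h
        · have := hall d h
          omega
        · have : d = m - 1 - i := by omega
          subst this
          omega
      omega
  · push Not at hall
    obtain ⟨e, he, hne⟩ := hall
    obtain ⟨d, hd, hd', hlt⟩ := (hup (i - k)).exists_lt (e := e)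
      (by rwa [shift_iterate_apply])
    simp only [shift_iterate_apply] at hd' hlt
    refine ⟨d, by omega, fun j hj => ?_, ?_⟩
    · rw [hmid j (by omega), hd' j hj]
    · rw [hmid d (by omega)]
      have := haM d
      omega

theorem perSeq_wMinus_prefixWord (a : ℕ → ℕ) {n : ℕ} (hn : 1 ≤ n) (i : ℕ) :
    perSeq (wMinus (prefixWord a n)) i =
      if i % n = n - 1 then a (n - 1) - 1 else a (i % n) := by
  obtain ⟨n, rfl⟩ : ∃ p, n = p + 1 := ⟨n - 1, by omega⟩
  have hw : wMinus (prefixWord a (n + 1)) = (List.range n).map a ++ [a n - 1] := by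
    simp [wMinus, prefixWord, List.range_succ, List.getLast!_eq_getLast?_getD]
  have hlt : i % (n + 1) < n + 1 := Nat.mod_lt i (Nat.succ_pos n)
  have hlen : ((List.range n).map a ++ [a n - 1]).length = n + 1 := by simp
  rw [hw, perSeq, hlen, Nat.add_sub_cancel]
  split_ifs with h
  · rw [h]
    simp
  · have h' : i % (n + 1) < n := by omega
    rw [List.getD_append _ _ _ _ (by simpa using h')]
    simp [List.getD_eq_getElem?_getD, h']

theorem memV_perSeq_of_reflected_prefix_lt {M m : ℕ} {a : ℕ → ℕ} (hm : 2 ≤ m) (haM : memSigma M a)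
    (hup : ∀ n, lexLE (shift^[n] a) a)
    (hlow : ∀ k < m, ∃ d, k + d < m ∧ (∀ j < d, a (k + j) = M - a j) ∧ M - a d < a (k + d)) :
    memV M (perSeq (wMinus (prefixWord a m))) := by
  set b := perSeq (wMinus (prefixWord a m)) with hb
  have hbval : ∀ i, b i = if i % m = m - 1 then a (m - 1) - 1 else a (i % m) :=
    perSeq_wMinus_prefixWord a (by omega)
  have hbper : ∀ i, b (i % m) = b i := fun i => by simp [hbval]
  have hba : ∀ i < m - 1, b i = a i := fun i hi => by
    rw [hbval, Nat.mod_eq_of_lt (by omega), if_neg (by omega)]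
  have hblast : b (m - 1) = a (m - 1) - 1 := by
    rw [hbval, Nat.mod_eq_of_lt (by omega), if_pos rfl]
  have hbM : memSigma M b := fun i => by
    rw [hbval]
    split_ifs
    · exact (Nat.sub_le _ _).trans (haM _)
    · exact haM _
  have hle0 : ∀ n, a n ≤ a 0 := fun n => by
    by_contra hcon
    obtain ⟨d, hd, -, hlt⟩ := (hup n).exists_lt (e := 0) (by rw [shift_iterate_apply]; simp; omega)
    obtain rfl : d = 0 := by omega
    rw [shift_iterate_apply] at hlt
    exact hcon (by simpa using hlt.le)
  have hapos : M - a 0 < a (m - 1) := by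
    obtain ⟨d, hd, -, hlt⟩ := hlow (m - 1) (by omega)
    obtain rfl : d = 0 := by omega
    simpa using hlt
  have hmod : ∀ n, shift^[n] b = shift^[n % m] b := fun n => by
    funext j
    rw [shift_iterate_apply, shift_iterate_apply, ← hbper, ← hbper (n % m + j), Nat.mod_add_mod]
  have hlower : ∀ d i, i < m → (∀ j < d, b (i + j) = M - b j) → M - b d ≤ b (i + d) := by
    intro d
    induction d using Nat.strong_induction_on with
    | _ d ih =>
      intro i hi heq
      obtain ⟨e, he, heq', hlt⟩ := hlow i hi
      rcases Nat.eq_zero_or_pos i with rfl | hi0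
      · have h0 := hle0 (m - 1)
        have hb0 := hba 0 (by omega)
        rcases Nat.eq_zero_or_pos d with rfl | hd0
        · simp only [add_zero]
          omega
        · have := heq 0 hd0
          simp only [add_zero] at this
          omega
      have hbe : ∀ j, i + j < m → b j = a j := fun j hj => hba j (by omega)
      by_cases hd : i + d < m - 1
      · rw [hba _ hd, hbe d (by omega)]
        by_contra hcon
        rcases Nat.lt_trichotomy d e with h | rfl | h
        · have := heq' d h
          omega
        · omega
        · have := heq e h
          rw [hbe e he, hba _ (by omega)] at this
          omega
      · have hee : i + e = m - 1 := by
          by_contra hne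
          have := heq e (by omega)
          rw [hbe e he, hba _ (by omega)] at this
          omega
        rcases Nat.lt_or_ge e d with hed | hed
        · have hkey := ih (d - (m - i)) (by omega) (m - i) (by omega) (fun j hj => by
            have := heq (m - i + j) (by omega)
            rw [← hbper, show i + (m - i + j) = m + j by omega, Nat.add_mod_left, hbper] at this
            have h1 := hbM (m - i + j)
            omega)
          rw [← hbper (i + d), show i + d = m + (d - (m - i)) by omega, Nat.add_mod_left, hbper]
          rw [show m - i + (d - (m - i)) = d by omega] at hkey
          omega
        · have hde : d = e := by omega
          subst hde
          rw [hee, hblast, hbe d he]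
          rw [hee] at hlt
          omega
  refine ⟨hbM, fun n => ?_⟩
  rw [hmod]
  have hi : n % m < m := Nat.mod_lt _ (by omega)
  generalize n % m = i at hi
  constructor
  · rcases lexLE_or_lexLT (reflSeq M b) (shift^[i] b) with h | ⟨d, hd, hlt⟩
    · exact h
    · simp only [shift_iterate_apply, reflSeq] at hd hlt
      have := hlower d i hi hd
      omega
  · rcases Nat.eq_zero_or_pos i with rfl | hi0
    · exact Or.inl rfl
    right
    by_cases hall : ∀ j ≤ m - 1 - i, a (i + j) = a j
    · refine ⟨m - 1 - i, fun j hj => ?_, ?_⟩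
      · rw [shift_iterate_apply, hba _ (by omega), hba _ (by omega), hall j hj.le]
      · have := hall (m - 1 - i) le_rfl
        rw [show i + (m - 1 - i) = m - 1 by omega] at this
        rw [shift_iterate_apply, show i + (m - 1 - i) = m - 1 by omega, hblast, hba _ (by omega)]
        omega
    · push Not at hall
      obtain ⟨e, he, hne⟩ := hall
      obtain ⟨d, hd, heq, hlt⟩ := (hup i).exists_lt (e := e) (by rwa [shift_iterate_apply])
      simp only [shift_iterate_apply] at heq hlt
      refine ⟨d, fun j hj => ?_, ?_⟩
      · rw [shift_iterate_apply, hba _ (by omega), hba _ (by omega), heq j hj]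
      · rw [shift_iterate_apply, hba d (by omega)]
        by_cases hdl : i + d = m - 1
        · rw [hdl, hblast]
          rw [hdl] at hlt
          omega
        · rwa [hba _ (by omega)]

/-! ### Quasi-greedy expansions -/

theorem memSigma.shift_iterate {M : ℕ} {b : ℕ → ℕ} (hb : memSigma M b) (n : ℕ) :
    memSigma M (shift^[n] b) := fun i => by
  rw [shift_iterate_apply]
  exact hb _

theorem memSigma.div_pow_le {M : ℕ} {b : ℕ → ℕ} (hb : memSigma M b) {q : ℝ} (hq : 0 < q) (i : ℕ) :
    (b i : ℝ) / q ^ (i + 1) ≤ M / q ^ (i + 1) := by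
  have : (b i : ℝ) ≤ M := by exact_mod_cast hb i
  gcongr

theorem memSigma.summable {M : ℕ} {b : ℕ → ℕ} (hb : memSigma M b) {q : ℝ} (hq : 1 < q) :
    Summable fun i : ℕ => (b i : ℝ) / q ^ (i + 1) :=
  Summable.of_nonneg_of_le (fun i => by positivity) (hb.div_pow_le (by linarith))
    (hasSum_const_div_pow_succ hq M).summable

theorem memSigma.tsum_le {M : ℕ} {b : ℕ → ℕ} (hb : memSigma M b) {q : ℝ} (hq : 1 < q) :
    ∑' i : ℕ, (b i : ℝ) / q ^ (i + 1) ≤ M / (q - 1) :=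
  hasSum_le (hb.div_pow_le (by linarith)) (hb.summable hq).hasSum (hasSum_const_div_pow_succ hq M)

theorem memSigma.tsum_eq_sum_add {M : ℕ} {b : ℕ → ℕ} (hb : memSigma M b) {q : ℝ} (hq : 1 < q)
    (n : ℕ) : ∑' i : ℕ, (b i : ℝ) / q ^ (i + 1) = ∑ i ∈ Finset.range n, (b i : ℝ) / q ^ (i + 1) +
      (∑' i : ℕ, (shift^[n] b i : ℝ) / q ^ (i + 1)) / q ^ n := by
  rw [← (hb.summable hq).sum_add_tsum_nat_add n, ← tsum_div_const]
  congr 2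
  funext i
  rw [shift_iterate_apply, div_div, ← pow_add, add_comm i n]
  ring_nf

theorem sum_add_inv_pow_le_of_lt {x y : ℕ → ℕ} {d : ℕ} (heq : ∀ j < d, x j = y j)
    (hlt : x d < y d) {q : ℝ} (hq : 0 < q) :
    ∑ i ∈ Finset.range (d + 1), (x i : ℝ) / q ^ (i + 1) + 1 / q ^ (d + 1) ≤
      ∑ i ∈ Finset.range (d + 1), (y i : ℝ) / q ^ (i + 1) := by
  rw [Finset.sum_range_succ, Finset.sum_range_succ, add_assoc, ← add_div,
    Finset.sum_congr rfl fun i hi => by rw [heq i (Finset.mem_range.1 hi)]]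
  have : (x d : ℝ) + 1 ≤ y d := by exact_mod_cast hlt
  gcongr

theorem tsum_shift_iterate_le_one {M : ℕ} {b : ℕ → ℕ} (hb : memSigma M b)
    (hup : ∀ n, lexLE (shift^[n] b) b) {q : ℝ} (hq : 1 < q)
    (hsum : ∑' i : ℕ, (b i : ℝ) / q ^ (i + 1) = 1) (n : ℕ) :
    ∑' i : ℕ, (shift^[n] b i : ℝ) / q ^ (i + 1) ≤ 1 := by
  have hq0 : 0 < q := by linarith
  set C : ℝ := M / (q - 1) with hC
  have hC0 : 0 ≤ C := div_nonneg (by positivity) (by linarith)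
  have key : ∀ t n : ℕ, ∑' i : ℕ, (shift^[n] b i : ℝ) / q ^ (i + 1) ≤ 1 + C / q ^ t := by
    intro t
    induction t with
    | zero =>
      intro n
      have := (hb.shift_iterate n).tsum_le hq
      simp only [pow_zero, div_one]
      linarith
    | succ t ih =>
      intro n
      rcases hup n with h | ⟨d, heq, hlt⟩
      · rw [h, hsum]
        have : 0 ≤ C / q ^ (t + 1) := by positivity
        linarith
      · rw [(hb.shift_iterate n).tsum_eq_sum_add hq (d + 1), ← Function.iterate_add_apply]
        have h1 := sum_add_inv_pow_le_of_lt heq hlt hq0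
        have h2 := (hb.summable hq).sum_le_tsum (Finset.range (d + 1))
          fun i _ => by positivity
        rw [hsum] at h2
        have h3 : (∑' i : ℕ, (shift^[d + 1 + n] b i : ℝ) / q ^ (i + 1)) / q ^ (d + 1) ≤
            (1 + C / q ^ t) / q ^ (d + 1) := by
          gcongr
          exact ih _
        have h4 : (1 + C / q ^ t) / q ^ (d + 1) ≤ 1 / q ^ (d + 1) + C / q ^ (t + 1) := by
          rw [add_div, div_div, ← pow_add]
          have : C / q ^ (t + (d + 1)) ≤ C / q ^ (t + 1) := by
            gcongr
            · exact hq.le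
            · omega
          linarith
        linarith
  have hlim : Filter.Tendsto (fun t : ℕ => 1 + C / q ^ t) Filter.atTop (nhds (1 + 0)) :=
    (tendsto_const_nhds.div_atTop (tendsto_pow_atTop_atTop_of_one_lt hq)).const_add 1
  rw [add_zero] at hlim
  exact ge_of_tendsto' hlim fun t => key t n

theorem isQuasiGreedy_of_forall_shift_le {M : ℕ} {b : ℕ → ℕ} (hb : memSigma M b)
    (hup : ∀ n, lexLE (shift^[n] b) b) (hinf : ∀ n, ∃ m ≥ n, b m ≠ 0) {q : ℝ} (hq : 1 < q)
    (hsum : ∑' i : ℕ, (b i : ℝ) / q ^ (i + 1) = 1) : IsQuasiGreedy M q b := by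
  have hq0 : 0 < q := by linarith
  refine ⟨hb, hinf, hsum, fun c hc hcinf hcsum => ?_⟩
  rcases lexLE_or_lexLT c b with h | ⟨d, heq, hlt⟩
  · exact h
  exfalso
  have h1 := sum_add_inv_pow_le_of_lt heq hlt hq0
  have h2 := hb.tsum_eq_sum_add hq (d + 1)
  have h3 : (∑' i : ℕ, (shift^[d + 1] b i : ℝ) / q ^ (i + 1)) / q ^ (d + 1) ≤ 1 / q ^ (d + 1) := by
    gcongr
    exact tsum_shift_iterate_le_one hb hup hq hsum _
  have h4 := hc.tsum_eq_sum_add hq (d + 1)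
  obtain ⟨m, hm, hcm⟩ := hcinf (d + 1)
  have h5 : 0 < (∑' i : ℕ, (shift^[d + 1] c i : ℝ) / q ^ (i + 1)) / q ^ (d + 1) := by
    refine div_pos (((hc.shift_iterate _).summable hq).tsum_pos (fun i => by positivity)
      (m - (d + 1)) ?_) (by positivity)
    rw [shift_iterate_apply, show d + 1 + (m - (d + 1)) = m by omega]
    have : (0 : ℝ) < c m := by exact_mod_cast Nat.pos_of_ne_zero hcm
    positivity
  linarith

theorem IsQuasiGreedy.qg_eq {M : ℕ} {q : ℝ} {b : ℕ → ℕ} (hb : IsQuasiGreedy M q b) :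
    qg M q = b := by
  have hex : ∃ a, IsQuasiGreedy M q a := ⟨b, hb⟩
  have ha : IsQuasiGreedy M q (qg M q) := by
    rw [qg, dif_pos hex]
    exact hex.choose_spec
  exact (hb.2.2.2 _ ha.1 ha.2.1 ha.2.2.1).antisymm (ha.2.2.2 _ hb.1 hb.2.1 hb.2.2.1)

theorem exists_tsum_eq_one {M : ℕ} (hM : 1 ≤ M) {b : ℕ → ℕ} (hb : memSigma M b) (h0 : b 0 ≠ 0)
    {n : ℕ} (hn : 1 ≤ n) (hbn : b n ≠ 0) :
    ∃ q : ℝ, 1 < q ∧ q ≤ M + 1 ∧ ∑' i : ℕ, (b i : ℝ) / q ^ (i + 1) = 1 := by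
  have hM' : (1 : ℝ) ≤ M := by exact_mod_cast hM
  set q₀ : ℝ := 2 ^ ((n + 1 : ℕ) : ℝ)⁻¹ with hq₀
  have hpow : q₀ ^ (n + 1) = 2 := Real.rpow_inv_natCast_pow (by norm_num) (by omega)
  have h1 : 1 < q₀ := Real.one_lt_rpow (by norm_num) (by positivity)
  have h2 : q₀ ≤ 2 := by
    rw [← hpow]
    exact le_self_pow₀ h1.le (by omega)
  have hcont : ContinuousOn (fun q : ℝ => ∑' i : ℕ, (b i : ℝ) / q ^ (i + 1))
      (Set.Icc q₀ (M + 1)) := by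
    refine continuousOn_tsum (u := fun i : ℕ => M / q₀ ^ (i + 1)) (fun i => ?_)
      (hasSum_const_div_pow_succ h1 M).summable fun i q hq => ?_
    · refine continuousOn_const.div (by fun_prop) fun q hq => ?_
      have : 0 < q := by linarith [hq.1]
      positivity
    · have hq0 : 0 < q := by linarith [hq.1]
      rw [Real.norm_of_nonneg (by positivity)]
      refine (hb.div_pow_le hq0 i).trans ?_
      have := hq.1
      gcongr
  have hhi : ∑' i : ℕ, (b i : ℝ) / (M + 1 : ℝ) ^ (i + 1) ≤ 1 := by
    have := hb.tsum_le (q := M + 1) (by linarith)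
    rwa [add_sub_cancel_right, div_self (by linarith)] at this
  have hlo : 1 ≤ ∑' i : ℕ, (b i : ℝ) / q₀ ^ (i + 1) := by
    have h := (hb.summable h1).sum_le_tsum {0, n} fun i _ => by positivity
    rw [Finset.sum_pair (by omega), hpow] at h
    have hb0 : (1 : ℝ) ≤ b 0 := by exact_mod_cast Nat.one_le_iff_ne_zero.2 h0
    have hbn' : (1 : ℝ) ≤ b n := by exact_mod_cast Nat.one_le_iff_ne_zero.2 hbn
    have h3 : (1 : ℝ) / 2 ≤ b 0 / q₀ ^ (0 + 1) := by
      rw [zero_add, pow_one]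
      gcongr
    linarith
  obtain ⟨q, hq, hqs⟩ := intermediate_value_Icc' (by linarith) hcont ⟨hhi, hlo⟩
  exact ⟨q, by linarith [hq.1], hq.2, hqs⟩

theorem memV.infinite_ne_zero {M : ℕ} (hM : 1 ≤ M) {b : ℕ → ℕ} (hb : memV M b) (n : ℕ) :
    ∃ m ≥ n, b m ≠ 0 := by
  by_contra! hcon
  have hall : ∀ e, b e = M := fun e => by
    by_contra hne
    obtain ⟨d, hd, -, hlt⟩ := (hb.2 n).1.exists_lt (e := e) (by
      rw [shift_iterate_apply, reflSeq, hcon (n + e) (by omega)]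
      have := hb.1 e
      omega)
    rw [shift_iterate_apply, hcon (n + d) (by omega)] at hlt
    omega
  have := hall n
  rw [hcon n le_rfl] at this
  omega

theorem qg_baseOf {M : ℕ} (hM : 1 ≤ M) {b : ℕ → ℕ} (hb : memV M b) :
    qg M (baseOf M b) = b := by
  have hinf := hb.infinite_ne_zero hM
  have h0 : b 0 ≠ 0 := by
    obtain ⟨m, -, hm⟩ := hinf 0
    by_contra hcon
    obtain ⟨d, hd, -, hlt⟩ := (hb.2 m).2.exists_lt (e := 0)
      (by rw [shift_iterate_apply, hcon]; simpa using hm)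
    obtain rfl : d = 0 := by omega
    omega
  obtain ⟨n, hn, hbn⟩ := hinf 1
  obtain ⟨q, hq1, hq2, hsum⟩ := exists_tsum_eq_one hM hb.1 h0 hn hbn
  have hex : ∃ q : ℝ, 1 < q ∧ q ≤ M + 1 ∧ qg M q = b :=
    ⟨q, hq1, hq2, (isQuasiGreedy_of_forall_shift_le hb.1 (fun n => (hb.2 n).2) hinf hq1 hsum).qg_eq⟩
  rw [baseOf, dif_pos hex]
  exact hex.choose_spec.2.2

/-! ### The natural approximation from below -/

theorem approxIdx_spec {M : ℕ} {q : ℝ}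
    (hunb : ∀ K, ∃ n ≥ K, memV M (perSeq (wMinus (prefixWord (qg M q) n)))) (m : ℕ) :
    m + 1 ≤ approxIdx M q m ∧
      memV M (perSeq (wMinus (prefixWord (qg M q) (approxIdx M q m)))) := by
  induction m with
  | zero => exact Nat.sInf_mem (s := {n : ℕ | 1 ≤ n ∧ _}) (hunb 1)
  | succ m ih =>
    have hmem := Nat.sInf_mem (s := {n : ℕ | approxIdx M q m < n ∧
      memV M (perSeq (wMinus (prefixWord (qg M q) n)))}) (hunb (approxIdx M q m + 1))
    exact ⟨lt_of_le_of_lt ih.1 hmem.1, hmem.2⟩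

/-- The languages of the natural approximations from below stabilise:
for each word length `k` the sets of admissible words eventually coincide with those
of `V_q`. -/
theorem Bn_eventually_stable (M : ℕ) (hM : 1 ≤ M) (q : ℝ) (hq : memUbar M q) :
    ∀ k : ℕ, ∃ J : ℕ, ∀ m ≥ J,
      Bn (Vq M q) k = Bn (Vq M (approxBase M q m)) k ∧
        Bn (Vq M (approxBase M q m)) k = Bn (Vq M (approxBase M q J)) k := by
  have hsub : memSigma M (qg M q) := by
    by_cases hex : ∃ a, IsQuasiGreedy M q a
    · rw [qg, dif_pos hex]
      exact hex.choose_spec.1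
    · rw [qg, dif_neg hex]
      exact fun i => Nat.zero_le M
  have hV : memV M (qg M q) := ⟨hsub, fun n => ⟨Or.inr (hq.2.2 n).1, (hq.2.2 n).2⟩⟩
  have hunb : ∀ K, ∃ n ≥ K, memV M (perSeq (wMinus (prefixWord (qg M q) n))) := fun K => by
    obtain ⟨m, hm, hlow⟩ := exists_forall_reflected_prefix_lt hsub (fun n => (hq.2.2 n).1)
      (fun n => (hq.2.2 n).2) (K + 2)
    exact ⟨m, by omega,
      memV_perSeq_of_reflected_prefix_lt (by omega) hsub (fun n => (hq.2.2 n).2) hlow⟩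
  intro k
  have key : ∀ m ≥ k, Bn (Vq M q) k = Bn (Vq M (approxBase M q m)) k := fun m hm => by
    obtain ⟨hidx, hb⟩ := approxIdx_spec hunb m
    have hqg : qg M (approxBase M q m) = _ := qg_baseOf hM hb
    change Bn (symmShift M (qg M q)) k = Bn (symmShift M (qg M (approxBase M q m))) k
    rw [hqg]
    refine Bn_symmShift_eq hV hb fun i hi => ?_
    rw [perSeq_wMinus_prefixWord _ (by omega), Nat.mod_eq_of_lt (by omega), if_neg (by omega)]
  exact ⟨k, fun m hm => ⟨key m hm, (key m hm).symm.trans (key k le_rfl)⟩⟩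
end
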